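/- Let X_c, X_o be Gramians of the antistable system S₋ and σ₁ its largest Hankel singular value. Then σ₁ is the optimal RH∞-approximation error of G: (lower bound) for every stable system Ŝ (of any order n̂, with m inputs and p outputs) and every ε > 0 there exists ω ∈ ℝ with ‖G(iω) − G_{Ŝ}(iω)‖₂ > σ₁ − ε; and (attainment) there exists a stable system Ŝ (of some order, with m inputs and p outputs) such that ‖G(iω) − G_{Ŝ}(iω)‖₂ ≤ σ₁ for all ω ∈ ℝ. In other words, the infimum over all stable systems Ŝ of the supremum over ω ∈ ℝ of ‖G(iω) − G_{Ŝ}(iω)‖₂ equals σ₁ and is attained. -/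

import Mathlib

open Matrix

noncomputable section

/-- Entrywise complexification of a real matrix. -/
def cplx {ι κ : Type*} (M : Matrix ι κ ℝ) : Matrix ι κ ℂ :=
  M.map fun x => (x : ℂ)

/-- The matrix pair (E, A) is regular: det(sE − A) ≠ 0 for some s ∈ ℂ. -/
def RegularPair {ι : Type*} [Fintype ι] [DecidableEq ι] (E A : Matrix ι ι ℝ) : Prop :=
  ∃ s : ℂ, (s • cplx E - cplx A).det ≠ 0

/-- (E, A) is stable: sE − A is invertible for every s with Re s ≥ 0. -/
def StablePair {ι : Type*} [Fintype ι] [DecidableEq ι] (E A : Matrix ι ι ℝ) : Prop :=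
  ∀ s : ℂ, 0 ≤ s.re → IsUnit (s • cplx E - cplx A)

/-- (E, A) is antistable: E invertible and sE − A invertible for every s with Re s ≤ 0. -/
def AntistablePair {ι : Type*} [Fintype ι] [DecidableEq ι] (E A : Matrix ι ι ℝ) : Prop :=
  IsUnit E ∧ ∀ s : ℂ, s.re ≤ 0 → IsUnit (s • cplx E - cplx A)

/-- Transfer function G(s) = C (sE − A)⁻¹ B + D of the system (E, A, B, C, D). -/
def transfer {ι κm κp : Type*} [Fintype ι] [DecidableEq ι]
    (E A : Matrix ι ι ℝ) (B : Matrix ι κm ℝ) (C : Matrix κp ι ℝ) (D : Matrix κp κm ℝ)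
    (s : ℂ) : Matrix κp κm ℂ :=
  cplx C * (s • cplx E - cplx A)⁻¹ * cplx B + cplx D

/-- Spectral norm (ℓ² operator norm) of a complex matrix. -/
def spec2 {κp κm : Type*} [Fintype κp] [Fintype κm] [DecidableEq κm]
    (M : Matrix κp κm ℂ) : ℝ :=
  ‖LinearMap.toContinuousLinearMap (Matrix.toEuclideanLin M)‖

/-- Squared Frobenius norm of a complex matrix. -/
def frobSq {κp κm : Type*} [Fintype κp] [Fintype κm] (M : Matrix κp κm ℂ) : ℝ :=
  ∑ i, ∑ j, ‖M i j‖ ^ 2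

/-- `Xc`, `Xo` are controllability/observability Gramians of the system (E, A, B, C, ·). -/
def IsGramians {ι κm κp : Type*} [Fintype ι] [Fintype κm] [Fintype κp]
    (E A : Matrix ι ι ℝ) (B : Matrix ι κm ℝ) (C : Matrix κp ι ℝ)
    (Xc Xo : Matrix ι ι ℝ) : Prop :=
  Xc.IsSymm ∧ Xo.IsSymm ∧
    A * Xc * Eᵀ + E * Xc * Aᵀ + B * Bᵀ = 0 ∧
    Aᵀ * Xo * E + Eᵀ * Xo * A + Cᵀ * C = 0

/-- σ₁ ≥ 0 is the largest Hankel singular value: σ₁² is the greatest eigenvalue of XcEᵀXoE. -/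
def IsLargestHSV {ι : Type*} [Fintype ι] [DecidableEq ι]
    (E Xc Xo : Matrix ι ι ℝ) (σ1 : ℝ) : Prop :=
  0 ≤ σ1 ∧ ((σ1 : ℂ) ^ 2) ∈ spectrum ℂ (cplx (Xc * Eᵀ * Xo * E)) ∧
    ∀ μ ∈ spectrum ℂ (cplx (Xc * Eᵀ * Xo * E)), μ.re ≤ σ1 ^ 2

/-- R_γ = XoEXcEᵀ − γ²I. -/
def Rg {ι : Type*} [Fintype ι] [DecidableEq ι] (E Xc Xo : Matrix ι ι ℝ) (γ : ℝ) :
    Matrix ι ι ℝ :=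
  Xo * E * Xc * Eᵀ - γ ^ 2 • (1 : Matrix ι ι ℝ)

/-- E_γ = Eᵀ R_γ. -/
def Eg {ι : Type*} [Fintype ι] [DecidableEq ι] (E Xc Xo : Matrix ι ι ℝ) (γ : ℝ) :
    Matrix ι ι ℝ :=
  Eᵀ * Rg E Xc Xo γ

/-- C_γ = C Xc Eᵀ. -/
def Cg {ι κp : Type*} [Fintype ι] (C : Matrix κp ι ℝ) (E Xc : Matrix ι ι ℝ) :
    Matrix κp ι ℝ :=
  C * Xc * Eᵀ

/-- A_γ = −Aᵀ R_γ − Cᵀ C_γ. -/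
def Ag {ι κp : Type*} [Fintype ι] [Fintype κp] [DecidableEq ι]
    (E A : Matrix ι ι ℝ) (C : Matrix κp ι ℝ) (Xc Xo : Matrix ι ι ℝ) (γ : ℝ) :
    Matrix ι ι ℝ :=
  -(Aᵀ * Rg E Xc Xo γ) - Cᵀ * Cg C E Xc

/-- B_γ = Eᵀ Xo B. -/
def Bg {ι κm : Type*} [Fintype ι] (E Xo : Matrix ι ι ℝ) (B : Matrix ι κm ℝ) :
    Matrix ι κm ℝ :=
  Eᵀ * Xo * B

/-- The point iω on the imaginary axis. -/
def iax (ω : ℝ) : ℂ := (ω : ℂ) * Complex.I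

/-- Canonical equivalence Fin k ⊕ Fin d ≃ Fin n given k + d = n. -/
def finBlockEquiv {k d n : ℕ} (h : k + d = n) : Fin k ⊕ Fin d ≃ Fin n :=
  finSumFinEquiv.trans (finCongr h)

end

noncomputable section

/-- `φ` agrees on `S` with a quotient of polynomials whose denominator has no zero in `S`. -/
def RatOn (S : Set ℂ) (φ : ℂ → ℂ) : Prop :=
  ∃ n d : Polynomial ℂ, ∀ z ∈ S, d.eval z ≠ 0 ∧ φ z = n.eval z / d.eval z

namespace RatOn

variable {S : Set ℂ} {φ ψ : ℂ → ℂ}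

lemma polynomial (q : Polynomial ℂ) : RatOn S fun z => q.eval z :=
  ⟨q, 1, fun z _ => by simp⟩

lemma const (c : ℂ) : RatOn S fun _ => c :=
  ⟨Polynomial.C c, 1, fun z _ => by simp⟩

lemma add (hφ : RatOn S φ) (hψ : RatOn S ψ) : RatOn S fun z => φ z + ψ z := by
  obtain ⟨n, d, h⟩ := hφ
  obtain ⟨n', d', h'⟩ := hψ
  refine ⟨n * d' + d * n', d * d', fun z hz => ?_⟩
  obtain ⟨h1, h2⟩ := h z hz
  obtain ⟨h1', h2'⟩ := h' z hz
  refine ⟨by simp [h1, h1'], ?_⟩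
  simp only [h2, h2', Polynomial.eval_add, Polynomial.eval_mul]
  rw [div_add_div _ _ h1 h1']

lemma mul (hφ : RatOn S φ) (hψ : RatOn S ψ) : RatOn S fun z => φ z * ψ z := by
  obtain ⟨n, d, h⟩ := hφ
  obtain ⟨n', d', h'⟩ := hψ
  refine ⟨n * n', d * d', fun z hz => ?_⟩
  obtain ⟨h1, h2⟩ := h z hz
  obtain ⟨h1', h2'⟩ := h' z hz
  refine ⟨by simp [h1, h1'], ?_⟩
  simp only [h2, h2', Polynomial.eval_mul]
  rw [div_mul_div_comm]

lemma sub (hφ : RatOn S φ) (hψ : RatOn S ψ) : RatOn S fun z => φ z - ψ z := by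
  simpa [sub_eq_add_neg] using hφ.add ((RatOn.const (-1)).mul hψ)

lemma sum {ι : Type*} (s : Finset ι) {f : ι → ℂ → ℂ} (h : ∀ i, RatOn S (f i)) :
    RatOn S fun z => ∑ i ∈ s, f i z := by
  classical
  induction s using Finset.induction_on with
  | empty => simpa using RatOn.const 0
  | insert a s ha ih => simpa [Finset.sum_insert ha] using (h a).add ih

lemma congr (hφ : RatOn S φ) (h : ∀ z ∈ S, ψ z = φ z) : RatOn S ψ := by
  obtain ⟨n, d, hd⟩ := hφ
  exact ⟨n, d, fun z hz => ⟨(hd z hz).1, (h z hz).trans (hd z hz).2⟩⟩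

lemma exists_bound (hS : IsCompact S) (hφ : RatOn S φ) : ∃ K, ∀ z ∈ S, ‖φ z‖ ≤ K := by
  obtain ⟨n, d, h⟩ := hφ
  have hc : ContinuousOn (fun z => n.eval z / d.eval z) S :=
    n.continuous.continuousOn.div d.continuous.continuousOn fun z hz => (h z hz).1
  obtain ⟨K, hK⟩ := hS.exists_bound_of_continuousOn hc
  exact ⟨K, fun z hz => by rw [(h z hz).2]; exact hK z hz⟩

end RatOn

/-- All entries of the matrix function `M` are rational on `S`. -/
def RatMatOn {ι κ : Type*} (S : Set ℂ) (M : ℂ → Matrix ι κ ℂ) : Prop :=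
  ∀ i j, RatOn S fun z => M z i j

namespace RatMatOn

variable {S : Set ℂ} {ι κ l : Type*}

lemma const (M : Matrix ι κ ℂ) : RatMatOn S fun _ => M := fun _ _ => RatOn.const _

lemma mul [Fintype κ] {M : ℂ → Matrix ι κ ℂ} {N : ℂ → Matrix κ l ℂ}
    (hM : RatMatOn S M) (hN : RatMatOn S N) : RatMatOn S fun z => M z * N z := fun i j => by
  simp only [Matrix.mul_apply]
  exact RatOn.sum _ fun k => (hM i k).mul (hN k j)

lemma add {M N : ℂ → Matrix ι κ ℂ} (hM : RatMatOn S M) (hN : RatMatOn S N) :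
    RatMatOn S fun z => M z + N z := fun i j => (hM i j).add (hN i j)

lemma sub {M N : ℂ → Matrix ι κ ℂ} (hM : RatMatOn S M) (hN : RatMatOn S N) :
    RatMatOn S fun z => M z - N z := fun i j => (hM i j).sub (hN i j)

lemma smul {φ : ℂ → ℂ} {M : ℂ → Matrix ι κ ℂ} (hφ : RatOn S φ) (hM : RatMatOn S M) :
    RatMatOn S fun z => φ z • M z := fun i j => hφ.mul (hM i j)

lemma dotProduct_mulVec [Fintype ι] [Fintype κ] {M : ℂ → Matrix ι κ ℂ} (hM : RatMatOn S M)
    (a : ι → ℂ) (b : κ → ℂ) : RatOn S fun z => a ⬝ᵥ (M z *ᵥ b) := by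
  simp only [dotProduct, Matrix.mulVec]
  exact RatOn.sum _ fun i => (RatOn.const _).mul (RatOn.sum _ fun j => (hM i j).mul (RatOn.const _))

lemma inv_pencil [Fintype ι] [DecidableEq ι] (E A : Matrix ι ι ℂ)
    (h : ∀ z ∈ S, IsUnit (z • E + A)) : RatMatOn S fun z => (z • E + A)⁻¹ := fun i j => by
  set M : Matrix ι ι (Polynomial ℂ) :=
    (Polynomial.X : Polynomial ℂ) • E.map Polynomial.C + A.map Polynomial.C with hM
  have hev (z : ℂ) : (Polynomial.evalRingHom z).mapMatrix M = z • E + A := by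
    ext i j
    simp [hM, mul_comm (E i j)]
  refine ⟨M.adjugate i j, M.det, fun z hz => ?_⟩
  have hdet : M.det.eval z = (z • E + A).det := by
    rw [← hev z, ← RingHom.map_det]; rfl
  have hadj : (M.adjugate i j).eval z = (z • E + A).adjugate i j := by
    rw [← hev z, ← RingHom.map_adjugate]; rfl
  have hu := (Matrix.isUnit_iff_isUnit_det _).1 (h z hz)
  refine ⟨by rw [hdet]; exact hu.ne_zero, ?_⟩
  simp only [hdet, hadj, Matrix.inv_def, Ring.inverse_eq_inv', Matrix.smul_apply, smul_eq_mul,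
    div_eq_inv_mul]

end RatMatOn

lemma one_mem_closure_unit_circle_diff :
    (1 : ℂ) ∈ closure (Metric.sphere (0 : ℂ) 1 \ {1}) := by
  have h1 : Filter.Tendsto (fun t : ℝ => Complex.exp (t * Complex.I)) (nhdsWithin 0 (Set.Ioo 0 1))
      (nhds 1) := by
    have : Continuous fun t : ℝ => Complex.exp (t * Complex.I) := by fun_prop
    simpa using (this.tendsto 0).mono_left nhdsWithin_le_nhds
  have : (nhdsWithin (0 : ℝ) (Set.Ioo 0 1)).NeBot := by
    rw [← mem_closure_iff_nhdsWithin_neBot, closure_Ioo (by norm_num)]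
    simp
  refine mem_closure_of_tendsto h1 ?_
  filter_upwards [self_mem_nhdsWithin] with t ht
  refine ⟨by simp [Complex.norm_exp], ?_⟩
  rw [Set.mem_singleton_iff, Complex.exp_eq_one_iff]
  rintro ⟨n, hn⟩
  have h2 : t = n * (2 * Real.pi) := by
    have := congrArg Complex.im hn
    simpa using this
  have hpi := Real.pi_gt_three
  have h3 : (0 : ℝ) < n := by
    by_contra! hc
    nlinarith [ht.1]
  have h4 : (1 : ℝ) ≤ n := by exact_mod_cast (by exact_mod_cast h3 : (0 : ℤ) < n)
  nlinarith [ht.2]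

/-- A boundary estimate for the real part of a rational function propagates to the centre of the
unit disc, even if one boundary point is excluded, provided the function is bounded there. -/
lemma re_div_eval_zero_le (K δ : ℝ) (n d : Polynomial ℂ)
    (hd : ∀ z ∈ Metric.closedBall (0 : ℂ) 1 \ {1}, d.eval z ≠ 0)
    (hK : ∀ z ∈ Metric.sphere (0 : ℂ) 1 \ {1}, ‖n.eval z‖ ≤ K * ‖d.eval z‖)
    (hδ : ∀ z ∈ Metric.sphere (0 : ℂ) 1 \ {1}, (n.eval z / d.eval z).re ≤ δ) :
    (n.eval 0 / d.eval 0).re ≤ δ := by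
  induction hk : d.natDegree using Nat.strong_induction_on generalizing n d with
  | _ k ih =>
  by_cases h1 : d.eval 1 = 0
  · have hn1 : n.eval 1 = 0 := by
      have hcl : IsClosed {z : ℂ | ‖n.eval z‖ ≤ K * ‖d.eval z‖} :=
        isClosed_le (by fun_prop) (by fun_prop)
      have h2 : ‖n.eval 1‖ ≤ K * ‖d.eval 1‖ :=
        closure_minimal hK hcl one_mem_closure_unit_circle_diff
      simpa [h1] using h2
    obtain ⟨d', rfl⟩ := Polynomial.dvd_iff_isRoot.2 h1
    obtain ⟨n', rfl⟩ := Polynomial.dvd_iff_isRoot.2 hn1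
    have hcancel (z : ℂ) (hz : z ≠ 1) :
        ((Polynomial.X - Polynomial.C 1) * n').eval z / ((Polynomial.X - Polynomial.C 1) * d').eval z
          = n'.eval z / d'.eval z := by
      simp only [Polynomial.eval_mul, Polynomial.eval_sub, Polynomial.eval_X, Polynomial.eval_C]
      exact mul_div_mul_left _ _ (sub_ne_zero.2 hz)
    have hd0 : d' ≠ 0 := by
      rintro rfl
      exact hd 0 (by simp) (by simp)
    rw [hcancel 0 zero_ne_one]
    refine ih d'.natDegree ?_ n' d' ?_ ?_ ?_ rfl
    · rw [← hk, Polynomial.natDegree_mul (Polynomial.X_sub_C_ne_zero 1) hd0,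
        Polynomial.natDegree_X_sub_C]
      omega
    · intro z hz h
      exact hd z hz (by simp [h])
    · intro z hz
      have h2 := hK z hz
      simp only [Polynomial.eval_mul, Polynomial.eval_sub, Polynomial.eval_X, Polynomial.eval_C,
        norm_mul] at h2
      have h3 : 0 < ‖z - 1‖ := norm_pos_iff.2 (sub_ne_zero.2 hz.2)
      refine le_of_mul_le_mul_left ?_ h3
      linarith
    · intro z hz
      rw [← hcancel z hz.2]
      exact hδ z hz
  · have hd' : ∀ z ∈ Metric.closedBall (0 : ℂ) 1, d.eval z ≠ 0 := fun z hz => by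
      by_cases h : z = 1
      · rwa [h]
      · exact hd z ⟨hz, h⟩
    have hcont : ContinuousOn (fun z => n.eval z / d.eval z) (Metric.closedBall 0 1) :=
      n.continuous.continuousOn.div d.continuous.continuousOn hd'
    have hδ' : ∀ z ∈ Metric.sphere (0 : ℂ) 1, (n.eval z / d.eval z).re ≤ δ := by
      intro z hz
      by_cases h : z = 1
      · subst h
        have hc : ContinuousWithinAt (fun z => (n.eval z / d.eval z).re)
            (Metric.sphere (0 : ℂ) 1 \ {1}) 1 :=
          (Complex.continuous_re.comp_continuousOn hcont).continuousWithinAt (by simp) |>.mono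
            fun z hz => Metric.sphere_subset_closedBall hz.1
        exact hc.closure_le one_mem_closure_unit_circle_diff continuousWithinAt_const hδ
      · exact hδ z ⟨hz, h⟩
    have hdc : DiffContOnCl ℂ (fun z => Complex.exp (n.eval z / d.eval z)) (Metric.ball 0 1) := by
      refine ⟨fun z hz => ?_, ?_⟩
      · exact ((n.differentiable z).div (d.differentiable z)
          (hd' z (Metric.ball_subset_closedBall hz))).cexp.differentiableWithinAt
      · rw [closure_ball _ one_ne_zero]
        exact hcont.cexp
    have := Complex.norm_le_of_forall_mem_frontier_norm_le Metric.isBounded_ball hdc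
      (C := Real.exp δ) (fun z hz => by
        rw [frontier_ball _ one_ne_zero] at hz
        rw [Complex.norm_exp]
        exact Real.exp_le_exp.2 (hδ' z hz)) (z := 0) (subset_closure (by simp))
    rw [Complex.norm_exp] at this
    exact Real.exp_le_exp.1 this

/-- Cayley transform of the unit disc onto the right half-plane. -/
def cayley (z : ℂ) : ℂ := (1 + z) / (1 - z)

lemma cayley_re_nonneg {z : ℂ} (hz : z ∈ Metric.closedBall (0 : ℂ) 1) : 0 ≤ (cayley z).re := by
  have h : Complex.normSq z ≤ 1 := by
    rw [Complex.normSq_eq_norm_sq]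
    have : ‖z‖ ≤ 1 := by simpa using hz
    nlinarith [norm_nonneg z]
  rw [cayley, Complex.div_re, ← add_div]
  refine div_nonneg ?_ (Complex.normSq_nonneg _)
  rw [Complex.normSq_apply] at h
  simp
  nlinarith

lemma cayley_eq_iax {z : ℂ} (hz : z ∈ Metric.sphere (0 : ℂ) 1) :
    cayley z = iax (cayley z).im := by
  have h : Complex.normSq z = 1 := by
    rw [Complex.normSq_eq_norm_sq]
    have : ‖z‖ = 1 := by simpa using hz
    simp [this]
  have hre : (cayley z).re = 0 := by
    rw [cayley, Complex.div_re, ← add_div]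
    rw [Complex.normSq_apply] at h
    simp only [Complex.add_re, Complex.sub_re, Complex.add_im, Complex.sub_im, Complex.one_re,
      Complex.one_im]
    rw [show (1 + z.re) * (1 - z.re) + (0 + z.im) * (0 - z.im) = 0 by linarith, zero_div]
  apply Complex.ext <;> simp [iax, hre]

lemma ratOn_cayley {S : Set ℂ} (hS : (1 : ℂ) ∉ S) : RatOn S cayley :=
  ⟨1 + Polynomial.X, 1 - Polynomial.X, fun z hz =>
    ⟨by simpa [sub_eq_zero] using fun h : (1 : ℂ) = z => hS (h ▸ hz), by simp [cayley]⟩⟩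

/-- Maximum principle for rational functions on the right half-plane. -/
lemma re_le_of_axis_le (Ψ : ℂ → ℂ)
    (hr : RatOn (Metric.closedBall 0 1 \ {1}) fun z => Ψ (cayley z)) (K δ : ℝ)
    (hK : ∀ ω : ℝ, ‖Ψ (iax ω)‖ ≤ K) (hδ : ∀ ω : ℝ, (Ψ (iax ω)).re ≤ δ) : (Ψ 1).re ≤ δ := by
  obtain ⟨n, d, h⟩ := hr
  dsimp only at h
  have hsub : Metric.sphere (0 : ℂ) 1 \ {1} ⊆ Metric.closedBall 0 1 \ {1} :=
    Set.sdiff_subset_sdiff_left Metric.sphere_subset_closedBall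
  have h0 : Ψ 1 = n.eval 0 / d.eval 0 := by simpa [cayley] using (h 0 (by simp)).2
  rw [h0]
  refine re_div_eval_zero_le K δ n d (fun z hz => (h z hz).1) (fun z hz => ?_) fun z hz => ?_
  · obtain ⟨h1, h2⟩ := h z (hsub hz)
    have h3 := hK (cayley z).im
    rw [← cayley_eq_iax hz.1, h2, norm_div] at h3
    exact (div_le_iff₀ (norm_pos_iff.2 h1)).1 h3
  · rw [← (h z (hsub hz)).2, cayley_eq_iax hz.1]
    exact hδ _

lemma cayley_pencil {ι : Type*} [DecidableEq ι] (E A : Matrix ι ι ℂ) {z : ℂ} (hz : z ≠ 1) :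
    z • (E + A) + (E - A) = (1 - z) • (cayley z • E - A) := by
  have : 1 - z ≠ 0 := sub_ne_zero.2 hz.symm
  rw [smul_sub, smul_smul, cayley, mul_div_cancel₀ _ this]
  module

section Resolvent

variable {ι : Type*} [Fintype ι] [DecidableEq ι] {E A : Matrix ι ι ℂ}

lemma isUnit_cayley_pencil (h : ∀ s : ℂ, 0 ≤ s.re → IsUnit (s • E - A)) {z : ℂ}
    (hz : z ∈ Metric.closedBall (0 : ℂ) 1) (hz1 : z ≠ 1) : IsUnit (z • (E + A) + (E - A)) := by
  rw [cayley_pencil E A hz1]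
  exact (h _ (cayley_re_nonneg hz)).smul (Units.mk0 _ (sub_ne_zero.2 hz1.symm))

lemma inv_cayley_pencil (h : ∀ s : ℂ, 0 ≤ s.re → IsUnit (s • E - A)) {z : ℂ}
    (hz : z ∈ Metric.closedBall (0 : ℂ) 1) (hz1 : z ≠ 1) :
    (cayley z • E - A)⁻¹ = (1 - z) • (z • (E + A) + (E - A))⁻¹ := by
  have h1 : 1 - z ≠ 0 := sub_ne_zero.2 hz1.symm
  have h2 := (Matrix.isUnit_iff_isUnit_det _).1 (h _ (cayley_re_nonneg hz))
  rw [cayley_pencil E A hz1]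
  have h3 : ((1 - z) • (cayley z • E - A))⁻¹ = (1 - z)⁻¹ • (cayley z • E - A)⁻¹ :=
    Matrix.inv_smul' _ (Units.mk0 _ h1) h2
  rw [h3, smul_smul, mul_inv_cancel₀ h1, one_smul]

lemma ratMatOn_resolvent (h : ∀ s : ℂ, 0 ≤ s.re → IsUnit (s • E - A)) :
    RatMatOn (Metric.closedBall 0 1 \ {1}) fun z => (cayley z • E - A)⁻¹ := by
  have h1 : RatOn (Metric.closedBall (0 : ℂ) 1 \ {1}) fun z => 1 - z :=
    (RatOn.const 1).sub (by simpa using RatOn.polynomial Polynomial.X)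
  intro i j
  refine (RatMatOn.smul h1 (RatMatOn.inv_pencil _ _ fun z hz =>
    isUnit_cayley_pencil h hz.1 hz.2) i j).congr fun z hz => ?_
  dsimp only
  rw [inv_cayley_pencil h hz.1 hz.2]

lemma exists_bound_resolvent (h : ∀ s : ℂ, 0 ≤ s.re → IsUnit (s • (1 : Matrix ι ι ℂ) - A))
    (a b : ι → ℂ) :
    ∃ K, ∀ ω : ℝ, ‖(1 - iax ω) * (a ⬝ᵥ ((iax ω • 1 - A)⁻¹ *ᵥ b))‖ ≤ K := by
  have hu (z : ℂ) (hz : z ∈ Metric.closedBall (0 : ℂ) 1) : IsUnit (z • (1 + A) + (1 - A)) := by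
    by_cases hz1 : z = 1
    · rw [hz1, show (1 : ℂ) • (1 + A) + (1 - A) = (2 : ℂ) • (1 : Matrix ι ι ℂ) by module]
      exact isUnit_one.smul (Units.mk0 (2 : ℂ) two_ne_zero)
    · exact isUnit_cayley_pencil h hz hz1
  obtain ⟨K, hK⟩ := ((RatMatOn.inv_pencil _ _ hu).dotProduct_mulVec a b).exists_bound
    (isCompact_closedBall _ _)
  refine ⟨2 * K, fun ω => ?_⟩
  have hs : iax ω + 1 ≠ 0 := fun h => by simpa [iax] using congrArg Complex.re h
  set z := (iax ω - 1) / (iax ω + 1) with hz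
  have hnorm : ‖z‖ = 1 := by
    have h1 : ‖iax ω - 1‖ = ‖iax ω + 1‖ := by
      rw [← sq_eq_sq₀ (norm_nonneg _) (norm_nonneg _), ← Complex.normSq_eq_norm_sq,
        ← Complex.normSq_eq_norm_sq, Complex.normSq_apply, Complex.normSq_apply]
      simp [iax]
    rw [hz, norm_div, h1, div_self (norm_ne_zero_iff.2 hs)]
  have hz1 : 1 - z = 2 / (iax ω + 1) := by
    rw [hz]; field_simp; ring
  have hne : z ≠ 1 := fun h => by
    rw [h, sub_self] at hz1
    exact div_ne_zero two_ne_zero hs hz1.symm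
  have hmem : z ∈ Metric.closedBall (0 : ℂ) 1 := by simp [hnorm]
  have hc : cayley z = iax ω := by
    rw [cayley, hz1, hz]; field_simp; ring
  rw [← hc, inv_cayley_pencil h hmem hne, Matrix.smul_mulVec, dotProduct_smul, smul_eq_mul,
    ← mul_assoc, norm_mul]
  have h2 : (1 - cayley z) * (1 - z) = -(2 * z) := by
    rw [cayley, sub_mul, div_mul_cancel₀ _ (sub_ne_zero.2 hne.symm)]; ring
  rw [h2, norm_neg, norm_mul, hnorm]
  simpa using hK z hmem

end Resolvent

lemma star_mulVec_dotProduct {ι κ : Type*} [Fintype ι] [Fintype κ] (M : Matrix ι κ ℂ)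
    (v : κ → ℂ) (w : ι → ℂ) : star (M *ᵥ v) ⬝ᵥ w = star v ⬝ᵥ (Mᴴ *ᵥ w) := by
  rw [Matrix.star_mulVec, ← Matrix.dotProduct_mulVec]

lemma star_iax (ω : ℝ) : star (iax ω) = -iax ω := by
  simp [iax]

lemma re_dotProduct_comm {ι : Type*} [Fintype ι] (v w : ι → ℂ) :
    (star v ⬝ᵥ w).re = (star w ⬝ᵥ v).re := by
  rw [Matrix.star_dotProduct, ← Complex.conj_re, starRingEnd_apply, star_star]

section Lyapunov

open scoped ComplexOrder

variable {ι κ : Type*} [Fintype ι] [Fintype κ] {A P : Matrix ι ι ℂ} {B : Matrix ι κ ℂ}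

lemma lyapunov_mulVec (hL : A * P + P * Aᴴ + B * Bᴴ = 0) (v : ι → ℂ) :
    B *ᵥ (Bᴴ *ᵥ v) = -(A *ᵥ (P *ᵥ v)) - P *ᵥ (Aᴴ *ᵥ v) := by
  have := congrArg (· *ᵥ v) hL
  simp only [Matrix.add_mulVec, Matrix.zero_mulVec, ← Matrix.mulVec_mulVec] at this
  rw [← sub_eq_zero, ← this]
  abel

lemma output_energy (hL : A * P + P * Aᴴ + B * Bᴴ = 0) (ω : ℝ)
    {v x : ι → ℂ} (hv : iax ω • v + Aᴴ *ᵥ v = x) :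
    star (Bᴴ *ᵥ v) ⬝ᵥ (Bᴴ *ᵥ v) = -(star x ⬝ᵥ (P *ᵥ v)) - star v ⬝ᵥ (P *ᵥ x) := by
  have h1 : Aᴴ *ᵥ v = x - iax ω • v := by rw [← hv]; abel
  have h2 : star v ⬝ᵥ (A *ᵥ (P *ᵥ v)) = star (Aᴴ *ᵥ v) ⬝ᵥ (P *ᵥ v) := by
    rw [star_mulVec_dotProduct, Matrix.conjTranspose_conjTranspose]
  rw [star_mulVec_dotProduct, Matrix.conjTranspose_conjTranspose, lyapunov_mulVec hL,
    dotProduct_sub, dotProduct_neg, h2, h1, star_sub, star_smul, star_iax]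
  simp only [Matrix.mulVec_sub, Matrix.mulVec_smul, dotProduct_sub, sub_dotProduct,
    smul_dotProduct, dotProduct_smul, neg_smul, neg_dotProduct]
  ring

variable [DecidableEq ι]

/-- The weighted energy of the output `Bᴴ (s + Aᴴ)⁻¹ x` on the imaginary axis. -/
lemma weighted_output_energy (hA : ∀ s : ℂ, 0 ≤ s.re → IsUnit (s • (1 : Matrix ι ι ℂ) - -Aᴴ))
    (hP : P.IsHermitian) (hL : A * P + P * Aᴴ + B * Bᴴ = 0) (ω : ℝ)
    {v x : ι → ℂ} (hv : iax ω • v + Aᴴ *ᵥ v = x) :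
    (1 + ω ^ 2) * (star (Bᴴ *ᵥ v) ⬝ᵥ (Bᴴ *ᵥ v)).re = -2 * (star x ⬝ᵥ (P *ᵥ x)).re -
      2 * ((1 - iax ω) * (star (P *ᵥ x) ⬝ᵥ
        ((iax ω • 1 - -Aᴴ)⁻¹ *ᵥ ((1 - Aᴴ) *ᵥ x)))).re := by
  set y := (iax ω • 1 - -Aᴴ)⁻¹ *ᵥ ((1 - Aᴴ) *ᵥ x) with hy
  have hdet := (Matrix.isUnit_iff_isUnit_det _).1 (hA (iax ω) (by simp [iax]))
  have h1 : (1 + iax ω) • v = x + y := by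
    have h2 : (iax ω • 1 - -Aᴴ) *ᵥ ((1 + iax ω) • v) = (iax ω • 1 - -Aᴴ) *ᵥ (x + y) := by
      rw [hy, Matrix.mulVec_add, Matrix.mulVec_mulVec, Matrix.mul_nonsing_inv _ hdet,
        Matrix.one_mulVec, Matrix.mulVec_smul]
      simp only [sub_neg_eq_add, Matrix.add_mulVec, Matrix.smul_mulVec, Matrix.one_mulVec,
        Matrix.sub_mulVec]
      rw [hv]
      module
    have := congrArg ((iax ω • 1 - -Aᴴ)⁻¹ *ᵥ ·) h2
    simpa only [Matrix.mulVec_mulVec, Matrix.nonsing_inv_mul _ hdet, Matrix.one_mulVec] using this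
  have h3 : (1 - iax ω) * (1 + iax ω) = ((1 + ω ^ 2 : ℝ) : ℂ) := by
    simp [iax]; ring_nf; simp
  have h4 : star v ⬝ᵥ (P *ᵥ x) = star (star x ⬝ᵥ (P *ᵥ v)) := by
    rw [Matrix.star_dotProduct, star_mulVec_dotProduct, hP.eq]
  have h5 : star (P *ᵥ x) ⬝ᵥ y = star x ⬝ᵥ (P *ᵥ y) := by
    rw [star_mulVec_dotProduct, hP.eq]
  have h6 : (star x ⬝ᵥ (P *ᵥ x)).im = 0 := by
    have := hP.im_star_dotProduct_mulVec_self x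
    simpa using this
  have h7 : ((1 + ω ^ 2 : ℝ) : ℂ) * (star x ⬝ᵥ (P *ᵥ v)) =
      (1 - iax ω) * (star x ⬝ᵥ (P *ᵥ x) + star (P *ᵥ x) ⬝ᵥ y) := by
    rw [← h3, h5, ← dotProduct_add, ← Matrix.mulVec_add, ← h1, Matrix.mulVec_smul,
      dotProduct_smul, smul_eq_mul, mul_assoc]
  have h8 : (1 + ω ^ 2) * (star x ⬝ᵥ (P *ᵥ v)).re = (star x ⬝ᵥ (P *ᵥ x)).re +
      ((1 - iax ω) * (star (P *ᵥ x) ⬝ᵥ y)).re := by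
    have := congrArg Complex.re h7
    rw [Complex.re_ofReal_mul, mul_add, Complex.add_re, Complex.mul_re (1 - iax ω), h6] at this
    simpa [iax] using this
  rw [output_energy hL ω hv, h4, Complex.sub_re, Complex.neg_re]
  simp only [Complex.star_def, Complex.conj_re]
  linarith

lemma solve_resolvent (hA : ∀ s : ℂ, 0 ≤ s.re → IsUnit (s • (1 : Matrix ι ι ℂ) - -Aᴴ)) {s : ℂ}
    (hs : 0 ≤ s.re) (x : ι → ℂ) :
    s • ((s • 1 - -Aᴴ)⁻¹ *ᵥ x) + Aᴴ *ᵥ ((s • 1 - -Aᴴ)⁻¹ *ᵥ x) = x := by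
  have hdet := (Matrix.isUnit_iff_isUnit_det _).1 (hA s hs)
  have := congrArg (· *ᵥ x) (Matrix.mul_nonsing_inv _ hdet)
  simp only [Matrix.one_mulVec, ← Matrix.mulVec_mulVec] at this
  simpa only [sub_neg_eq_add, Matrix.add_mulVec, Matrix.smul_mulVec, Matrix.one_mulVec] using this

lemma star_dotProduct_self_re_nonneg {ι : Type*} [Fintype ι] (v : ι → ℂ) :
    0 ≤ (star v ⬝ᵥ v).re := by
  exact (Complex.le_def.1 (dotProduct_star_self_nonneg v)).1

/-- Lyapunov's theorem: solutions of the Lyapunov equation inherit definiteness. -/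
lemma posSemidef_neg_of_lyapunov
    (hA : ∀ s : ℂ, 0 ≤ s.re → IsUnit (s • (1 : Matrix ι ι ℂ) - -Aᴴ))
    (hP : P.IsHermitian) (hL : A * P + P * Aᴴ + B * Bᴴ = 0) : (-P).PosSemidef := by
  refine Matrix.PosSemidef.of_dotProduct_mulVec_nonneg hP.neg fun x => ?_
  have him : (star x ⬝ᵥ (P *ᵥ x)).im = 0 := by
    simpa using hP.im_star_dotProduct_mulVec_self x
  obtain ⟨K, hK⟩ := exists_bound_resolvent hA (star (P *ᵥ x)) ((1 - Aᴴ) *ᵥ x)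
  set Ψ : ℂ → ℂ := fun s =>
    (1 - s) * (star (P *ᵥ x) ⬝ᵥ ((s • 1 - -Aᴴ)⁻¹ *ᵥ ((1 - Aᴴ) *ᵥ x))) with hΨ
  have hr : RatOn (Metric.closedBall 0 1 \ {1}) fun z => Ψ (cayley z) :=
    ((RatOn.const 1).sub (ratOn_cayley (by simp))).mul
      ((ratMatOn_resolvent hA).dotProduct_mulVec _ _)
  have hδ (ω : ℝ) : (Ψ (iax ω)).re ≤ -(star x ⬝ᵥ (P *ᵥ x)).re := by
    have h1 := weighted_output_energy hA hP hL ω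
      (solve_resolvent hA (s := iax ω) (by simp [iax]) x)
    have h2 := mul_nonneg (by positivity : 0 ≤ 1 + ω ^ 2)
      (star_dotProduct_self_re_nonneg (Bᴴ *ᵥ ((iax ω • 1 - -Aᴴ)⁻¹ *ᵥ x)))
    linarith
  have h1 := re_le_of_axis_le Ψ hr K _ hK hδ
  simp only [hΨ, sub_self, zero_mul, Complex.zero_re] at h1
  rw [Complex.le_def, Matrix.neg_mulVec, dotProduct_neg, Complex.neg_re, Complex.neg_im, him]
  exact ⟨h1, by simp⟩

end Lyapunov

lemma norm_star_dotProduct_le {ι : Type*} [Fintype ι] (v w : ι → ℂ) :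
    ‖star v ⬝ᵥ w‖ ≤ (star v ⬝ᵥ v).re + (star w ⬝ᵥ w).re := by
  simp only [dotProduct, Complex.re_sum, ← Finset.sum_add_distrib]
  refine (norm_sum_le _ _).trans (Finset.sum_le_sum fun i _ => ?_)
  have h (z : ℂ) : (star z * z).re = ‖z‖ ^ 2 := by
    rw [← Complex.normSq_eq_norm_sq, Complex.normSq_apply]; simp
  rw [Pi.star_apply, Pi.star_apply, h, h, norm_mul, norm_star]
  nlinarith [sq_nonneg (‖v i‖ - ‖w i‖), sq_nonneg ‖v i‖, sq_nonneg ‖w i‖]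

/-- The adjoint relation between the resolvents of `A` and `-Aᴴ` on the imaginary axis. -/
lemma star_dotProduct_resolvent {ι : Type*} [Fintype ι] {A : Matrix ι ι ℂ} {s : ℂ}
    (hs : star s = -s) {w t y z : ι → ℂ}
    (hw : s • w - A *ᵥ w = y) (ht : s • t + Aᴴ *ᵥ t = z) :
    star w ⬝ᵥ z = -(star y ⬝ᵥ t) := by
  rw [← hw, ← ht, star_sub, star_smul, hs, sub_dotProduct, star_mulVec_dotProduct]
  simp only [dotProduct_add, smul_dotProduct, dotProduct_smul, neg_smul, neg_dotProduct]
  ring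

section Hankel

open scoped ComplexOrder

variable {ι κm κp : Type*} [Fintype ι] [DecidableEq ι] [Fintype κm] [Fintype κp]
  {A P Q : Matrix ι ι ℂ} {B : Matrix ι κm ℂ} {C : Matrix κp ι ℂ}

lemma isUnit_smul_one_add_conjTranspose
    (hA : ∀ s : ℂ, s.re ≤ 0 → IsUnit (s • (1 : Matrix ι ι ℂ) - A)) (s : ℂ) (hs : 0 ≤ s.re) :
    IsUnit (s • (1 : Matrix ι ι ℂ) - -Aᴴ) := by
  have h := (hA (-star s) (by simpa using hs)).star.neg
  convert h using 1
  rw [Matrix.star_eq_conjTranspose]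
  simp [add_comm]

/-- Nehari's lower bound: no function that is rational on the closed right half-plane approximates
the antistable transfer function better than a Hankel singular value. -/
lemma hankel_lower_bound (hA : ∀ s : ℂ, s.re ≤ 0 → IsUnit (s • (1 : Matrix ι ι ℂ) - A))
    (hP : P.IsHermitian) (hQ : Q.IsHermitian) (hLP : A * P + P * Aᴴ + B * Bᴴ = 0)
    (hLQ : Aᴴ * Q + Q * A + Cᴴ * C = 0) {σ c : ℝ} (hc : 0 ≤ c) (hcσ : c < σ)
    {x : ι → ℂ} (hx0 : x ≠ 0) (hx : Q *ᵥ (P *ᵥ x) = ((σ : ℂ) ^ 2) • x)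
    (F : ℂ → Matrix κp κm ℂ)
    (hF : RatMatOn (Metric.closedBall 0 1 \ {1}) fun z => F (cayley z))
    (hbound : ∀ (ω : ℝ) (u : κm → ℂ),
      (star ((C * (iax ω • 1 - A)⁻¹ * B - F (iax ω)) *ᵥ u) ⬝ᵥ
        ((C * (iax ω • 1 - A)⁻¹ * B - F (iax ω)) *ᵥ u)).re ≤ c ^ 2 * (star u ⬝ᵥ u).re) :
    False := by
  have hN := isUnit_smul_one_add_conjTranspose hA
  have hneg := posSemidef_neg_of_lyapunov hN hP hLP
  obtain ⟨K, hK⟩ := exists_bound_resolvent hN (star (P *ᵥ x)) ((1 - Aᴴ) *ᵥ x)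
  set N : ℂ → Matrix ι ι ℂ := fun s => (s • 1 - -Aᴴ)⁻¹ with hNdef
  set f : ℂ → ℂ := fun s =>
    star (P *ᵥ x) ⬝ᵥ ((N s * Cᴴ * (F s * Bᴴ * N s - C * P * N s)) *ᵥ x) with hf
  set g : ℂ → ℂ := fun s => (1 - s) * (star (P *ᵥ x) ⬝ᵥ (N s *ᵥ ((1 - Aᴴ) *ᵥ x))) with hg
  set κ : ℝ := (σ ^ 2 - c ^ 2) / 2 with hκ
  have hκ0 : 0 < κ := by rw [hκ]; nlinarith
  set Ψ : ℂ → ℂ := fun s => (s * s - 1) * f s - 2 * κ * g s with hΨ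
  have hNr : RatMatOn (Metric.closedBall 0 1 \ {1}) fun z => N (cayley z) :=
    ratMatOn_resolvent hN
  have hcay : RatOn (Metric.closedBall 0 1 \ {1}) cayley := ratOn_cayley (by simp)
  have hfr : RatOn (Metric.closedBall 0 1 \ {1}) fun z => f (cayley z) :=
    (((hNr.mul (RatMatOn.const _)).mul (((hF.mul (RatMatOn.const _)).mul hNr).sub
      ((RatMatOn.const _).mul hNr))).dotProduct_mulVec _ _)
  have hgr : RatOn (Metric.closedBall 0 1 \ {1}) fun z => g (cayley z) :=
    ((RatOn.const 1).sub hcay).mul (hNr.dotProduct_mulVec _ _)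
  have hr : RatOn (Metric.closedBall 0 1 \ {1}) fun z => Ψ (cayley z) :=
    (((hcay.mul hcay).sub (RatOn.const 1)).mul hfr).sub ((RatOn.const _).mul hgr)
  have haxis (ω : ℝ) : ∃ e : ℝ, 0 ≤ e ∧
      (1 + ω ^ 2) * e = -2 * (star x ⬝ᵥ (P *ᵥ x)).re - 2 * (g (iax ω)).re ∧
      κ * e ≤ (f (iax ω)).re ∧ ‖f (iax ω)‖ ≤ (3 * σ ^ 2 + c ^ 2) * e := by
    set s := iax ω with hs
    have hre : s.re = 0 := by simp [hs, iax]
    have hstar : star s = -s := star_iax ω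
    set v := N s *ᵥ x with hv
    have hvx : s • v + Aᴴ *ᵥ v = x := solve_resolvent hN hre.ge x
    have hdet := (Matrix.isUnit_iff_isUnit_det _).1 (hA s hre.le)
    set w := (s • 1 - A)⁻¹ *ᵥ (P *ᵥ x) with hw
    have hwx : s • w - A *ᵥ w = P *ᵥ x := by
      have := congrArg (· *ᵥ (P *ᵥ x)) (Matrix.mul_nonsing_inv _ hdet)
      simp only [Matrix.one_mulVec] at this
      rw [← Matrix.mulVec_mulVec, ← hw] at this
      simpa only [Matrix.sub_mulVec, Matrix.smul_mulVec, Matrix.one_mulVec] using this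
    set u := Bᴴ *ᵥ v with hu
    set h := (C * (s • 1 - A)⁻¹ * B - F s) *ᵥ u with hh
    have hBu : B *ᵥ u = (s • 1 - A) *ᵥ (P *ᵥ v) - P *ᵥ x := by
      rw [hu, lyapunov_mulVec hLP, ← hvx]
      simp only [Matrix.sub_mulVec, Matrix.smul_mulVec, Matrix.one_mulVec, Matrix.mulVec_add,
        Matrix.mulVec_smul]
      abel
    have hLB : (s • 1 - A)⁻¹ *ᵥ (B *ᵥ u) = P *ᵥ v - w := by
      rw [hBu, Matrix.mulVec_sub, Matrix.mulVec_mulVec, Matrix.nonsing_inv_mul _ hdet,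
        Matrix.one_mulVec]
    have hhe : h = C *ᵥ (P *ᵥ v) - C *ᵥ w - F s *ᵥ u := by
      rw [hh, Matrix.sub_mulVec, ← Matrix.mulVec_mulVec, ← Matrix.mulVec_mulVec, hLB,
        Matrix.mulVec_sub]
    have hfe : f s = star (C *ᵥ w) ⬝ᵥ (C *ᵥ w) + star (C *ᵥ w) ⬝ᵥ h := by
      have h1 : (F s * Bᴴ * N s - C * P * N s) *ᵥ x = -(C *ᵥ w + h) := by
        rw [hhe, Matrix.sub_mulVec]
        simp only [← Matrix.mulVec_mulVec]
        rw [← hv, ← hu]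
        abel
      rw [← dotProduct_add, star_mulVec_dotProduct,
        star_dotProduct_resolvent hstar hwx (solve_resolvent hN hre.ge (Cᴴ *ᵥ (C *ᵥ w + h))), hf]
      dsimp only
      rw [← Matrix.mulVec_mulVec, h1, ← Matrix.mulVec_mulVec]
      simp only [Matrix.mulVec_neg, dotProduct_neg]
      rfl
    have hgu : (star (C *ᵥ w) ⬝ᵥ (C *ᵥ w)).re = σ ^ 2 * (star u ⬝ᵥ u).re := by
      have h1 := output_energy (A := Aᴴ) (P := Q) (B := Cᴴ)
        (by simpa only [Matrix.conjTranspose_conjTranspose] using hLQ) (-ω) (v := w)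
        (x := -(P *ᵥ x)) (by
          rw [Matrix.conjTranspose_conjTranspose, ← hwx,
            show iax (-ω) = -s by simp [hs, iax]]
          module)
      rw [Matrix.conjTranspose_conjTranspose, Matrix.mulVec_neg, hx, star_neg, neg_dotProduct,
        dotProduct_neg, neg_neg, sub_neg_eq_add, dotProduct_smul] at h1
      have h2 : star (P *ᵥ x) ⬝ᵥ (Q *ᵥ w) = ((σ : ℂ) ^ 2) * (star x ⬝ᵥ w) := by
        have := star_mulVec_dotProduct Q (P *ᵥ x) w
        rw [hQ.eq, hx, star_smul, smul_dotProduct] at this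
        rw [← this]
        simp
      have h3 := output_energy hLP ω hvx
      have h4 := star_dotProduct_resolvent hstar hwx hvx
      have h5 : (star x ⬝ᵥ w).re = (star w ⬝ᵥ x).re := re_dotProduct_comm _ _
      have h6 : star x ⬝ᵥ (P *ᵥ v) = star (P *ᵥ x) ⬝ᵥ v := by
        rw [star_mulVec_dotProduct, hP.eq]
      have h7 : (star v ⬝ᵥ (P *ᵥ x)).re = (star (P *ᵥ x) ⬝ᵥ v).re := re_dotProduct_comm _ _
      rw [h1, h2, smul_eq_mul, ← Complex.ofReal_pow, Complex.add_re, Complex.re_ofReal_mul,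
        Complex.re_ofReal_mul, h5, h4, h3, Complex.sub_re, Complex.neg_re, Complex.neg_re, h6, h7]
      ring
    have hhu : (star h ⬝ᵥ h).re ≤ c ^ 2 * (star u ⬝ᵥ u).re := hbound ω u
    have h0 : 0 ≤ (star (C *ᵥ w + h) ⬝ᵥ (C *ᵥ w + h)).re := star_dotProduct_self_re_nonneg _
    rw [star_add, add_dotProduct, dotProduct_add, dotProduct_add] at h0
    simp only [Complex.add_re] at h0
    rw [re_dotProduct_comm h] at h0
    refine ⟨(star u ⬝ᵥ u).re, star_dotProduct_self_re_nonneg u,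
      weighted_output_energy hN hP hLP ω hvx, ?_, ?_⟩
    · rw [hfe, Complex.add_re, hκ]
      nlinarith
    · have h1 := norm_star_dotProduct_le (C *ᵥ w) (C *ᵥ w)
      have h2 := norm_star_dotProduct_le (C *ᵥ w) h
      rw [hfe]
      refine (norm_add_le _ _).trans ?_
      nlinarith
  have hsq (ω : ℝ) : iax ω * iax ω - 1 = ((-(1 + ω ^ 2) : ℝ) : ℂ) := by
    simp [iax]; ring_nf; simp; ring
  have hre (ω : ℝ) : (Ψ (iax ω)).re ≤ 2 * κ * (star x ⬝ᵥ (P *ᵥ x)).re := by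
    obtain ⟨e, he0, he, hfe, -⟩ := haxis ω
    have h1 : (Ψ (iax ω)).re = -(1 + ω ^ 2) * (f (iax ω)).re - 2 * κ * (g (iax ω)).re := by
      rw [hΨ]
      dsimp only
      rw [hsq, Complex.sub_re, Complex.re_ofReal_mul,
        show (2 * (κ : ℂ)) = ((2 * κ : ℝ) : ℂ) by push_cast; rfl, Complex.re_ofReal_mul]
    have h2 := mul_le_mul_of_nonneg_left hfe (by positivity : 0 ≤ 1 + ω ^ 2)
    have h3 : (1 + ω ^ 2) * (κ * e) =
        κ * (-2 * (star x ⬝ᵥ (P *ᵥ x)).re - 2 * (g (iax ω)).re) := by rw [← he]; ring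
    rw [h1]
    linarith
  have hbd (ω : ℝ) : ‖Ψ (iax ω)‖ ≤
      (3 * σ ^ 2 + c ^ 2) * (-2 * (star x ⬝ᵥ (P *ᵥ x)).re + 2 * K) + 2 * κ * K := by
    obtain ⟨e, he0, he, -, hfn⟩ := haxis ω
    have hgK : ‖g (iax ω)‖ ≤ K := hK ω
    have hgre := (abs_le.1 (Complex.abs_re_le_norm (g (iax ω)))).1
    have hK0 : 0 ≤ K := (norm_nonneg _).trans hgK
    have hpos : (0 : ℝ) ≤ 1 + ω ^ 2 := by positivity
    have h1 : ‖((-(1 + ω ^ 2) : ℝ) : ℂ) * f (iax ω)‖ ≤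
        (3 * σ ^ 2 + c ^ 2) * (-2 * (star x ⬝ᵥ (P *ᵥ x)).re + 2 * K) := by
      rw [norm_mul, Complex.norm_real, Real.norm_eq_abs, abs_neg, abs_of_nonneg hpos]
      calc (1 + ω ^ 2) * ‖f (iax ω)‖ ≤ (1 + ω ^ 2) * ((3 * σ ^ 2 + c ^ 2) * e) :=
            mul_le_mul_of_nonneg_left hfn hpos
        _ = (3 * σ ^ 2 + c ^ 2) * ((1 + ω ^ 2) * e) := by ring
        _ ≤ _ := mul_le_mul_of_nonneg_left (by rw [he]; linarith) (by positivity)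
    have h2 : ‖2 * (κ : ℂ) * g (iax ω)‖ ≤ 2 * κ * K := by
      rw [norm_mul, norm_mul, Complex.norm_real, Real.norm_eq_abs, abs_of_pos hκ0,
        Complex.norm_ofNat]
      exact mul_le_mul_of_nonneg_left hgK (by positivity)
    rw [hΨ]
    dsimp only
    rw [hsq]
    exact (norm_sub_le _ _).trans (add_le_add h1 h2)
  have h1 := re_le_of_axis_le Ψ hr _ _ hbd hre
  have h2 : Ψ 1 = 0 := by simp [hΨ, hg]
  rw [h2, Complex.zero_re] at h1
  have h3 : 0 ≤ (star x ⬝ᵥ (P *ᵥ x)).re := by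
    by_contra! h
    nlinarith
  have h4 : star x ⬝ᵥ (-P *ᵥ x) = 0 := by
    have h5 := Complex.le_def.1 (hneg.dotProduct_mulVec_nonneg x)
    apply Complex.ext
    · refine le_antisymm ?_ h5.1
      simpa [Matrix.neg_mulVec] using h3
    · exact h5.2.symm
  have h5 := (hneg.dotProduct_mulVec_zero_iff x).1 h4
  rw [Matrix.neg_mulVec, neg_eq_zero] at h5
  rw [h5, Matrix.mulVec_zero] at hx
  have hσ : (σ : ℂ) ^ 2 ≠ 0 := by
    have : σ ≠ 0 := by linarith
    exact_mod_cast pow_ne_zero 2 this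
  exact hx0 ((smul_eq_zero.1 hx.symm).resolve_left hσ)

end Hankel

section Factor

open scoped MatrixOrder ComplexOrder Matrix.Norms.L2Operator

lemma Matrix.PosSemidef.exists_eq_conjTranspose_mul_self {ι : Type*} [Fintype ι] [DecidableEq ι]
    {M : Matrix ι ι ℂ} (hM : M.PosSemidef) : ∃ L : Matrix ι ι ℂ, M = Lᴴ * L :=
  CStarAlgebra.nonneg_iff_eq_star_mul_self.mp hM.nonneg

end Factor

section Nehari

open scoped ComplexOrder

variable {ι κm κp : Type*} [Fintype ι] [Fintype κm] [Fintype κp]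
  {A P Q : Matrix ι ι ℂ} {B : Matrix ι κm ℂ} {C : Matrix κp ι ℂ}

/-- The error identity for the optimal approximant: if `x` solves the resolvent equation of the
approximant at `iω` for the input `u`, the error output has energy at most `σ²` times that of
`u`. -/
lemma error_energy_le (hP : P.IsHermitian) (hQ : Q.IsHermitian)
    (hLP : A * P + P * Aᴴ + B * Bᴴ = 0) (hLQ : Aᴴ * Q + Q * A + Cᴴ * C = 0) {σ ω : ℝ}
    {u : κm → ℂ} {w x : ι → ℂ} (hw : iax ω • w - A *ᵥ w = B *ᵥ u)
    (hx : Q *ᵥ (P *ᵥ (iax ω • x + Aᴴ *ᵥ x)) - (σ : ℂ) ^ 2 • (iax ω • x + Aᴴ *ᵥ x) +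
      Q *ᵥ (B *ᵥ (Bᴴ *ᵥ x)) = Q *ᵥ (B *ᵥ u)) :
    (star (C *ᵥ (w - P *ᵥ x)) ⬝ᵥ (C *ᵥ (w - P *ᵥ x))).re ≤ σ ^ 2 * (star u ⬝ᵥ u).re := by
  set g := iax ω • x + Aᴴ *ᵥ x with hg
  set q := w - P *ᵥ x with hq
  have h1 : iax ω • q - A *ᵥ q = B *ᵥ u - B *ᵥ (Bᴴ *ᵥ x) - P *ᵥ g := by
    rw [hq, hg, ← hw, lyapunov_mulVec hLP]
    simp only [Matrix.mulVec_sub, Matrix.mulVec_add, Matrix.mulVec_smul]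
    module
  have h2 : Q *ᵥ (iax ω • q - A *ᵥ q) = -((σ : ℂ) ^ 2 • g) := by
    rw [h1, Matrix.mulVec_sub, Matrix.mulVec_sub, ← hx]
    abel
  have h3 := output_energy (A := Aᴴ) (P := Q) (B := Cᴴ)
    (by simpa only [Matrix.conjTranspose_conjTranspose] using hLQ) (-ω) (v := q)
    (x := -(iax ω • q - A *ᵥ q)) (by
      rw [Matrix.conjTranspose_conjTranspose, show iax (-ω) = -iax ω by simp [iax]]
      module)
  have h4 : star (-(iax ω • q - A *ᵥ q)) ⬝ᵥ (Q *ᵥ q) = ((σ : ℂ) ^ 2) * (star g ⬝ᵥ q) := by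
    have := star_mulVec_dotProduct Q (-(iax ω • q - A *ᵥ q)) q
    rw [hQ.eq] at this
    rw [← this, Matrix.mulVec_neg, h2, neg_neg, star_smul, smul_dotProduct]
    simp
  rw [Matrix.conjTranspose_conjTranspose, h4, Matrix.mulVec_neg, h2, neg_neg,
    dotProduct_smul, smul_eq_mul] at h3
  have h5 := star_dotProduct_resolvent (star_iax ω) hw hg.symm
  rw [star_mulVec_dotProduct] at h5
  have h6 := output_energy hLP ω hg.symm
  have h7 : star x ⬝ᵥ (P *ᵥ g) = star (P *ᵥ x) ⬝ᵥ g := by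
    rw [star_mulVec_dotProduct, hP.eq]
  have h8 : star q ⬝ᵥ g = star w ⬝ᵥ g - star (P *ᵥ x) ⬝ᵥ g := by
    rw [hq, star_sub, sub_dotProduct]
  have h9 := star_dotProduct_self_re_nonneg (u - Bᴴ *ᵥ x)
  rw [star_sub, sub_dotProduct, dotProduct_sub, dotProduct_sub] at h9
  simp only [Complex.sub_re] at h9
  rw [re_dotProduct_comm (Bᴴ *ᵥ x) u] at h9
  have h10 := congrArg Complex.re h6
  rw [h7, Complex.sub_re, Complex.neg_re, re_dotProduct_comm g] at h10
  have h11 := congrArg Complex.re h8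
  rw [h5, Complex.sub_re, Complex.neg_re] at h11
  rw [h3, ← Complex.ofReal_pow, Complex.sub_re, Complex.neg_re, Complex.re_ofReal_mul,
    Complex.re_ofReal_mul, re_dotProduct_comm g, h11]
  have := mul_nonneg (sq_nonneg σ) h9
  nlinarith

variable [DecidableEq ι]

/-- A spectral bound on `P * Q` turns into a quadratic form bound. -/
lemma posSemidef_mul_sub (hP : (-P).PosSemidef) (hQ : Q.IsHermitian) {c : ℝ} (hc : 0 ≤ c)
    (hs : ∀ μ ∈ spectrum ℂ (P * Q), μ.re ≤ c) :
    (P * (Q * P - (c : ℂ) • (1 : Matrix ι ι ℂ))).PosSemidef := by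
  obtain ⟨L, hL⟩ := hP.exists_eq_conjTranspose_mul_self
  have hPL : P = -(Lᴴ * L) := by rw [← hL, neg_neg]
  set T : Matrix ι ι ℂ := (c : ℂ) • 1 + L * Q * Lᴴ with hT
  have hTh : T.IsHermitian := by
    rw [Matrix.IsHermitian, hT]
    simp [Matrix.conjTranspose_mul, hQ.eq, Matrix.mul_assoc]
  have hTp : T.PosSemidef := by
    refine hTh.posSemidef_iff_eigenvalues_nonneg.2 fun i => ?_
    by_contra! hneg
    have hneg' : hTh.eigenvalues i < 0 := hneg
    set t := hTh.eigenvalues i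
    have h1 : (t : ℂ) ∈ spectrum ℂ T := by
      have := hTh.eigenvalues_mem_spectrum_real i
      exact spectrum.mem_iff.mpr this
    have h2 : ((c - t : ℝ) : ℂ) ∈ spectrum ℂ (L * (-(Q * Lᴴ))) := by
      rw [spectrum.mem_iff] at h1 ⊢
      intro h3
      apply h1
      convert h3.neg using 1
      rw [hT, Algebra.algebraMap_eq_smul_one, Algebra.algebraMap_eq_smul_one, Matrix.mul_neg,
        ← Matrix.mul_assoc]
      push_cast
      module
    have hct : 0 < c - t := by linarith
    have h0 : ((c - t : ℝ) : ℂ) ≠ 0 := by exact_mod_cast hct.ne'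
    have h3 : ((c - t : ℝ) : ℂ) ∈ spectrum ℂ (-(Q * Lᴴ) * L) \ {0} := by
      rw [← spectrum.nonzero_mul_comm]
      exact ⟨h2, h0⟩
    rw [show -(Q * Lᴴ) * L = Q * P by rw [hPL]; simp [Matrix.mul_assoc],
      spectrum.nonzero_mul_comm] at h3
    have := hs _ h3.1
    rw [Complex.ofReal_re] at this
    linarith
  have := hTp.conjTranspose_mul_mul_same L
  convert this using 1
  rw [hT, hPL]
  simp only [Matrix.mul_sub, Matrix.mul_add, Matrix.add_mul, Matrix.neg_mul, Matrix.mul_neg,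
    Matrix.mul_smul, Matrix.smul_mul, Matrix.mul_one, Matrix.mul_assoc]
  module

/-- A degenerate pair of Gramians kills the observability Gramian on the inputs. -/
lemma mul_input_eq_zero (hP : P.IsHermitian) (hQ : (-Q).PosSemidef)
    (hLP : A * P + P * Aᴴ + B * Bᴴ = 0) (hLQ : Aᴴ * Q + Q * A + Cᴴ * C = 0)
    (hK : (P * (Q * P)).PosSemidef) : Q * B = 0 := by
  have hQP : Q * P = 0 := by
    refine Matrix.ext_of_mulVec_single fun i => ?_
    have hy := (hQ.dotProduct_mulVec_zero_iff (P *ᵥ Pi.single i 1)).1 (le_antisymm ?_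
      (hQ.dotProduct_mulVec_nonneg _))
    · rw [← Matrix.mulVec_mulVec, Matrix.zero_mulVec]
      simpa [Matrix.neg_mulVec] using hy
    · have h := hK.dotProduct_mulVec_nonneg (Pi.single i 1)
      rw [star_mulVec_dotProduct, hP.eq, Matrix.neg_mulVec, Matrix.mulVec_neg, dotProduct_neg,
        neg_nonpos]
      simpa only [Matrix.mulVec_mulVec] using h
  have hPQ : P * Q = 0 := by
    have := congrArg Matrix.conjTranspose hQP
    have hQh : Q.IsHermitian := by simpa using hQ.1.neg
    rwa [Matrix.conjTranspose_mul, hP.eq, hQh.eq, Matrix.conjTranspose_zero] at this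
  have hCP : C * P = 0 := by
    rw [← Matrix.conjTranspose_mul_self_eq_zero, Matrix.conjTranspose_mul, hP.eq]
    have := congrArg (fun X => P * X * P) hLQ
    simp only [Matrix.mul_add, Matrix.add_mul, Matrix.mul_zero, Matrix.zero_mul] at this
    rw [Matrix.mul_assoc, Matrix.mul_assoc Aᴴ, hQP, ← Matrix.mul_assoc P Q, hPQ] at this
    simpa [Matrix.mul_assoc] using this
  have hQAP : Q * A * P = 0 := by
    have := congrArg (fun X => X * P) hLQ
    simp only [Matrix.add_mul, Matrix.zero_mul] at this
    rw [Matrix.mul_assoc Aᴴ, hQP, Matrix.mul_assoc Cᴴ, hCP] at this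
    simpa using this
  have := congrArg (fun X => Q * X) hLP
  simp only [Matrix.mul_add, Matrix.mul_zero, ← Matrix.mul_assoc] at this
  rw [hQAP, hQP] at this
  rw [← Matrix.mul_self_mul_conjTranspose_eq_zero, ← Matrix.mul_assoc]
  simpa using this

end Nehari

lemma eq_zero_of_star_dotProduct_self_re {ι : Type*} [Fintype ι] {v : ι → ℂ}
    (hv : (star v ⬝ᵥ v).re = 0) : v = 0 := by
  open scoped ComplexOrder in
  have h := Complex.le_def.1 (dotProduct_star_self_nonneg v)
  open scoped ComplexOrder in
  exact dotProduct_star_self_eq_zero.1 (Complex.ext hv h.2.symm)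

section Pencil

open scoped ComplexOrder

variable {ι κm κp : Type*} [Fintype ι] [DecidableEq ι] [Fintype κm] [Fintype κp]
  {A P Q J : Matrix ι ι ℂ} {B : Matrix ι κm ℂ} {C : Matrix κp ι ℂ} {c : ℂ}

/-- The two forms of the state matrix of the approximant. -/
lemma approximant_pencil_eq (hLP : A * P + P * Aᴴ + B * Bᴴ = 0)
    (hLQ : Aᴴ * Q + Q * A + Cᴴ * C = 0) (s : ℂ) :
    (s • 1 + Aᴴ) * (Q * P - c • 1) + Cᴴ * C * P =
      (Q * P - c • 1) * (s • 1 + Aᴴ) + Q * (B * Bᴴ) := by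
  have h1 : Cᴴ * C = -(Aᴴ * Q) - Q * A := by rw [← sub_eq_zero, ← hLQ]; abel
  have h2 : B * Bᴴ = -(A * P) - P * Aᴴ := by rw [← sub_eq_zero, ← hLP]; abel
  rw [h1, h2]
  simp only [Matrix.mul_sub, Matrix.sub_mul, Matrix.mul_add, Matrix.add_mul, Matrix.neg_mul,
    Matrix.mul_neg, Matrix.mul_smul, Matrix.smul_mul, Matrix.mul_one, Matrix.one_mul,
    Matrix.mul_assoc]
  module

lemma approximant_pencil_ker {σ : ℝ} (hσ : 0 < σ) (hP : P.IsHermitian) (hQ : Q.IsHermitian)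
    (hA : ∀ s : ℂ, 0 ≤ s.re → IsUnit (s • (1 : Matrix ι ι ℂ) - -Aᴴ))
    (hLP : A * P + P * Aᴴ + B * Bᴴ = 0) (hLQ : Aᴴ * Q + Q * A + Cᴴ * C = 0)
    (hK : (P * (Q * P - ((σ ^ 2 : ℝ) : ℂ) • (1 : Matrix ι ι ℂ))).PosSemidef)
    {s : ℂ} (hs : 0 ≤ s.re) {x : ι → ℂ}
    (hx : ((s • 1 + Aᴴ) * (Q * P - ((σ ^ 2 : ℝ) : ℂ) • 1) + Cᴴ * C * P) *ᵥ x = 0) :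
    (Q * P - ((σ ^ 2 : ℝ) : ℂ) • 1) *ᵥ x = 0 ∧ (C * P) *ᵥ x = 0 ∧ Bᴴ *ᵥ x = 0 := by
  set R := Q * P - ((σ ^ 2 : ℝ) : ℂ) • (1 : Matrix ι ι ℂ) with hR
  have hPR : Rᴴ * P = P * R := by
    have := hK.1.eq
    rwa [Matrix.conjTranspose_mul, hP.eq] at this
  set M := (s • 1 + Aᴴ) * R + Cᴴ * C * P with hM
  have h1 : P * M + Mᴴ * P = (2 * (s.re : ℂ)) • (P * R) + (C * P)ᴴ * (C * P) +
      ((σ ^ 2 : ℝ) : ℂ) • (B * Bᴴ) := by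
    have hs2 : (2 * (s.re : ℂ)) = s + star s := by
      rw [Complex.star_def, Complex.add_conj]; push_cast; rfl
    have h2 : B * Bᴴ = -(A * P) - P * Aᴴ := by rw [← sub_eq_zero, ← hLP]; abel
    have hRh : Rᴴ = P * Q - ((σ ^ 2 : ℝ) : ℂ) • 1 := by
      rw [hR, Matrix.conjTranspose_sub, Matrix.conjTranspose_mul, hP.eq, hQ.eq]
      simp
    have hMh : Mᴴ * P = star s • (P * R) + Rᴴ * A * P + P * (Cᴴ * C) * P := by
      rw [← hPR, hM]
      simp [Matrix.conjTranspose_mul, hP.eq, Matrix.add_mul, Matrix.mul_assoc]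
    have h3 : P * (Cᴴ * C) * P = -(P * (Aᴴ * Q) * P) - P * (Q * A) * P := by
      rw [← sub_eq_zero]
      have := congrArg (fun X => P * X * P) hLQ
      simp only [Matrix.mul_add, Matrix.add_mul, Matrix.mul_zero, Matrix.zero_mul] at this
      rw [← this]; abel
    have hPM : P * M = s • (P * R) + P * (Aᴴ * R) + P * (Cᴴ * C) * P := by
      simp [hM, Matrix.mul_add, Matrix.add_mul, Matrix.mul_assoc]
    have hCC : (C * P)ᴴ * (C * P) = P * (Cᴴ * C) * P := by
      simp [Matrix.conjTranspose_mul, hP.eq, Matrix.mul_assoc]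
    have h4 : P * (Aᴴ * R) + Rᴴ * A * P + P * (Cᴴ * C) * P =
        ((σ ^ 2 : ℝ) : ℂ) • (B * Bᴴ) := by
      rw [h3, h2, hRh, hR]
      simp only [Matrix.mul_sub, Matrix.sub_mul, Matrix.mul_smul, Matrix.smul_mul,
        Matrix.mul_one, Matrix.one_mul, Matrix.mul_assoc]
      module
    rw [hPM, hMh, hCC, ← h4, hs2]
    module
  have h2 : star x ⬝ᵥ ((P * M + Mᴴ * P) *ᵥ x) = 0 := by
    rw [Matrix.add_mulVec, ← Matrix.mulVec_mulVec, hx, Matrix.mulVec_zero, zero_add,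
      ← Matrix.mulVec_mulVec, ← star_mulVec_dotProduct, hx, star_zero, zero_dotProduct]
  rw [h1, Matrix.add_mulVec, Matrix.add_mulVec, dotProduct_add, dotProduct_add,
    ← Matrix.mulVec_mulVec _ (C * P)ᴴ, ← star_mulVec_dotProduct, Matrix.smul_mulVec,
    Matrix.smul_mulVec, dotProduct_smul, dotProduct_smul, ← Matrix.mulVec_mulVec _ B] at h2
  have h3 : star x ⬝ᵥ (B *ᵥ (Bᴴ *ᵥ x)) = star (Bᴴ *ᵥ x) ⬝ᵥ (Bᴴ *ᵥ x) := by
    rw [star_mulVec_dotProduct, Matrix.conjTranspose_conjTranspose]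
  have hk := (Complex.le_def.1 (hK.dotProduct_mulVec_nonneg x)).1
  have hb := star_dotProduct_self_re_nonneg (Bᴴ *ᵥ x)
  have hc := star_dotProduct_self_re_nonneg ((C * P) *ᵥ x)
  have h4 := congrArg Complex.re h2
  rw [h3, smul_eq_mul, smul_eq_mul, Complex.add_re, Complex.add_re, Complex.re_ofReal_mul,
    show 2 * (s.re : ℂ) = ((2 * s.re : ℝ) : ℂ) by push_cast; rfl, Complex.re_ofReal_mul,
    Complex.zero_re] at h4
  rw [Complex.zero_re] at hk
  have hσ2 : 0 < σ ^ 2 := by positivity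
  have e1 := mul_nonneg (mul_nonneg zero_le_two hs) hk
  have e2 := mul_nonneg hσ2.le hb
  have hc0 : ((star ((C * P) *ᵥ x)) ⬝ᵥ ((C * P) *ᵥ x)).re = 0 := by linarith
  have hb0 : (star (Bᴴ *ᵥ x) ⬝ᵥ (Bᴴ *ᵥ x)).re = 0 := by
    have : σ ^ 2 * (star (Bᴴ *ᵥ x) ⬝ᵥ (Bᴴ *ᵥ x)).re = 0 := by linarith
    exact (mul_eq_zero.1 this).resolve_left hσ2.ne'
  have hCP := eq_zero_of_star_dotProduct_self_re hc0
  refine ⟨?_, hCP, eq_zero_of_star_dotProduct_self_re hb0⟩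
  rw [hM, Matrix.add_mulVec, Matrix.mul_assoc, ← Matrix.mulVec_mulVec _ Cᴴ, hCP,
    Matrix.mulVec_zero, add_zero, ← Matrix.mulVec_mulVec] at hx
  have hu := hA s hs
  rw [sub_neg_eq_add] at hu
  have := congrArg ((s • 1 + Aᴴ)⁻¹ *ᵥ ·) hx
  simpa only [Matrix.mulVec_mulVec, ← Matrix.mul_assoc, Matrix.mulVec_zero, Matrix.one_mul,
    Matrix.nonsing_inv_mul _ ((Matrix.isUnit_iff_isUnit_det _).1 hu)] using this

/-- Adding a projection onto the common kernel to the pencil does not change the solutions of the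
resolvent equation. -/
lemma projection_mulVec_eq_zero (hc : c ≠ 0) (hP : P.IsHermitian)
    (hLP : A * P + P * Aᴴ + B * Bᴴ = 0) (hLQ : Aᴴ * Q + Q * A + Cᴴ * C = 0)
    (hK : (P * (Q * P - c • (1 : Matrix ι ι ℂ))).IsHermitian) (hQ : Q.IsHermitian)
    (hRJ : (Q * P - c • 1) * J = 0) (hBJ : Bᴴ * J = 0)
    {s : ℂ} {x : ι → ℂ} {u : κm → ℂ}
    (hx : ((s • 1 + Aᴴ) * (Q * P - c • 1) + Cᴴ * C * P + P * J) *ᵥ x = Q *ᵥ (B *ᵥ u)) :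
    J *ᵥ x = 0 := by
  have h1 : Jᴴ * P * (Q * P - c • 1) = 0 := by
    have h : (Q * P - c • 1)ᴴ * P = P * (Q * P - c • 1) := by
      have := hK.eq
      rwa [Matrix.conjTranspose_mul, hP.eq] at this
    rw [Matrix.mul_assoc, ← h, ← Matrix.mul_assoc, ← Matrix.conjTranspose_mul, hRJ,
      Matrix.conjTranspose_zero, Matrix.zero_mul]
  have hQPJ : Q * P * J = c • J := by
    rw [← sub_eq_zero, ← hRJ]
    simp [Matrix.sub_mul]
  have h2 : Jᴴ * P * Q * B = 0 := by
    have h : Jᴴ * P * Q = star c • Jᴴ := by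
      rw [← Matrix.conjTranspose_smul, ← hQPJ]
      simp [Matrix.conjTranspose_mul, hP.eq, hQ.eq, Matrix.mul_assoc]
    have h' := congrArg Matrix.conjTranspose hBJ
    rw [Matrix.conjTranspose_mul, Matrix.conjTranspose_conjTranspose,
      Matrix.conjTranspose_zero] at h'
    rw [h, Matrix.smul_mul, h', smul_zero]
  rw [approximant_pencil_eq hLP hLQ] at hx
  have h3 := congrArg ((Jᴴ * P) *ᵥ ·) hx
  rw [Matrix.mulVec_mulVec, Matrix.mulVec_mulVec, Matrix.mulVec_mulVec, h2, Matrix.mul_add,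
    Matrix.mul_add, ← Matrix.mul_assoc, h1, Matrix.zero_mul, ← Matrix.mul_assoc,
    ← Matrix.mul_assoc, h2, Matrix.zero_mul, zero_add, zero_add, Matrix.zero_mulVec] at h3
  have h4 : P *ᵥ (J *ᵥ x) = 0 := by
    rw [show Jᴴ * P * (P * J) = (P * J)ᴴ * (P * J) by
      rw [Matrix.conjTranspose_mul, hP.eq]] at h3
    have := (Matrix.conjTranspose_mul_self_mulVec_eq_zero (P * J) x).1 h3
    rwa [← Matrix.mulVec_mulVec] at this
  have h5 := congrArg (· *ᵥ x) hQPJ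
  rw [← Matrix.mulVec_mulVec, ← Matrix.mulVec_mulVec, h4, Matrix.mulVec_zero,
    Matrix.smul_mulVec] at h5
  exact (smul_eq_zero.1 h5.symm).resolve_left hc

end Pencil

section Complexification

variable {ι κ l : Type*}

lemma cplx_mul [Fintype κ] (M : Matrix ι κ ℝ) (N : Matrix κ l ℝ) :
    cplx (M * N) = cplx M * cplx N := Matrix.map_mul (f := Complex.ofRealHom)

lemma cplx_add (M N : Matrix ι κ ℝ) : cplx (M + N) = cplx M + cplx N := by
  ext; simp [cplx]

lemma cplx_sub (M N : Matrix ι κ ℝ) : cplx (M - N) = cplx M - cplx N := by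
  ext; simp [cplx]

lemma cplx_neg (M : Matrix ι κ ℝ) : cplx (-M) = -cplx M := by
  ext; simp [cplx]

lemma cplx_smul (r : ℝ) (M : Matrix ι κ ℝ) : cplx (r • M) = (r : ℂ) • cplx M := by
  ext; simp [cplx]

lemma cplx_zero : cplx (0 : Matrix ι κ ℝ) = 0 := by
  ext; simp [cplx]

lemma cplx_one [DecidableEq ι] : cplx (1 : Matrix ι ι ℝ) = 1 :=
  Matrix.map_one _ Complex.ofReal_zero Complex.ofReal_one

lemma cplx_transpose (M : Matrix ι κ ℝ) : cplx Mᵀ = (cplx M)ᴴ := by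
  ext; simp [cplx]

lemma cplx_isHermitian {M : Matrix ι ι ℝ} (hM : M.IsSymm) : (cplx M).IsHermitian := by
  rw [Matrix.IsHermitian, ← cplx_transpose, hM.eq]

lemma cplx_inv [Fintype ι] [DecidableEq ι] {M : Matrix ι ι ℝ} (hM : IsUnit M) :
    (cplx M)⁻¹ = cplx M⁻¹ := by
  refine Matrix.inv_eq_right_inv ?_
  rw [← cplx_mul, Matrix.mul_nonsing_inv _ ((Matrix.isUnit_iff_isUnit_det _).1 hM), cplx_one]

lemma re_cplx_mulVec [Fintype κ] (M : Matrix ι κ ℝ) (x : κ → ℂ) (i : ι) :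
    ((cplx M *ᵥ x) i).re = (M *ᵥ fun j => (x j).re) i := by
  simp [cplx, Matrix.mulVec, dotProduct]

lemma im_cplx_mulVec [Fintype κ] (M : Matrix ι κ ℝ) (x : κ → ℂ) (i : ι) :
    ((cplx M *ᵥ x) i).im = (M *ᵥ fun j => (x j).im) i := by
  simp [cplx, Matrix.mulVec, dotProduct]

/-- A real projection onto the common kernel of two real matrices. -/
lemma exists_kernel_projection [Fintype ι] [DecidableEq ι] (M : Matrix κ ι ℝ)
    (N : Matrix l ι ℝ) : ∃ J : Matrix ι ι ℝ, M * J = 0 ∧ N * J = 0 ∧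
      ∀ x : ι → ℂ, cplx M *ᵥ x = 0 → cplx N *ᵥ x = 0 → cplx J *ᵥ x = x := by
  set W : Submodule ℝ (ι → ℝ) := LinearMap.ker M.mulVecLin ⊓ LinearMap.ker N.mulVecLin
  obtain ⟨π, hπ⟩ := LinearMap.exists_leftInverse_of_injective W.subtype (Submodule.ker_subtype W)
  set J := LinearMap.toMatrix' (W.subtype ∘ₗ π) with hJ
  have hJv (v : ι → ℝ) : J *ᵥ v = π v := by
    rw [hJ, LinearMap.toMatrix'_mulVec]; rfl
  have hJW (v : ι → ℝ) (hM : M *ᵥ v = 0) (hN : N *ᵥ v = 0) : J *ᵥ v = v := by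
    rw [hJv]
    have := LinearMap.congr_fun hπ (⟨v, hM, hN⟩ : W)
    exact congrArg Subtype.val this
  refine ⟨J, ?_, ?_, fun x hM hN => ?_⟩
  · refine Matrix.ext_of_mulVec_single fun i => ?_
    rw [← Matrix.mulVec_mulVec, hJv, Matrix.zero_mulVec]
    exact (π (Pi.single i 1)).2.1
  · refine Matrix.ext_of_mulVec_single fun i => ?_
    rw [← Matrix.mulVec_mulVec, hJv, Matrix.zero_mulVec]
    exact (π (Pi.single i 1)).2.2
  · ext i
    refine Complex.ext ?_ ?_
    · rw [re_cplx_mulVec, hJW _ (funext fun j => ?_) (funext fun j => ?_)]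
      · rw [← re_cplx_mulVec, hM]; rfl
      · rw [← re_cplx_mulVec, hN]; rfl
    · rw [im_cplx_mulVec, hJW _ (funext fun j => ?_) (funext fun j => ?_)]
      · rw [← im_cplx_mulVec, hM]; rfl
      · rw [← im_cplx_mulVec, hN]; rfl

end Complexification

section SpectralNorm

variable {κp κm : Type*} [Fintype κp] [Fintype κm]

lemma star_dotProduct_self_re_eq_norm_sq {ι : Type*} [Fintype ι] (v : ι → ℂ) :
    (star v ⬝ᵥ v).re = ‖WithLp.toLp 2 v‖ ^ 2 := by
  rw [EuclideanSpace.norm_sq_eq, dotProduct, Complex.re_sum]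
  refine Finset.sum_congr rfl fun i _ => ?_
  rw [← Complex.normSq_eq_norm_sq, Complex.normSq_apply]
  simp

variable [DecidableEq κm]

lemma spec2_le_iff (M : Matrix κp κm ℂ) {c : ℝ} (hc : 0 ≤ c) :
    spec2 M ≤ c ↔ ∀ u : κm → ℂ, (star (M *ᵥ u) ⬝ᵥ (M *ᵥ u)).re ≤ c ^ 2 * (star u ⬝ᵥ u).re := by
  rw [spec2, ContinuousLinearMap.opNorm_le_iff hc]
  constructor
  · intro h u
    rw [star_dotProduct_self_re_eq_norm_sq, star_dotProduct_self_re_eq_norm_sq, ← mul_pow]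
    exact pow_le_pow_left₀ (norm_nonneg _) (h (WithLp.toLp 2 u)) 2
  · intro h x
    have := h x.ofLp
    rw [star_dotProduct_self_re_eq_norm_sq, star_dotProduct_self_re_eq_norm_sq, ← mul_pow] at this
    exact le_of_sq_le_sq this (mul_nonneg hc (norm_nonneg _))

lemma spec2_nonneg (M : Matrix κp κm ℂ) : 0 ≤ spec2 M := norm_nonneg _

end SpectralNorm

section Realization

variable {κm κp : Type*}

lemma transfer_normalize {ι : Type*} [Fintype ι] [DecidableEq ι] {E A : Matrix ι ι ℝ}
    (hE : IsUnit E) (B : Matrix ι κm ℝ) (C : Matrix κp ι ℝ) (D : Matrix κp κm ℝ) (s : ℂ) :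
    transfer E A B C D s = transfer 1 (E⁻¹ * A) (E⁻¹ * B) C D s := by
  have h : s • cplx E - cplx A = cplx E * (s • cplx 1 - cplx (E⁻¹ * A)) := by
    rw [Matrix.mul_sub, Matrix.mul_smul, ← cplx_mul, ← cplx_mul, Matrix.mul_one,
      Matrix.mul_nonsing_inv_cancel_left _ _ ((Matrix.isUnit_iff_isUnit_det _).1 hE)]
  rw [transfer, transfer, h, Matrix.mul_inv_rev, cplx_inv hE, cplx_mul E⁻¹ B]
  simp only [Matrix.mul_assoc]

/-- Parallel connection of two systems. -/
lemma exists_parallel {n₁ n₂ : ℕ} {E₁ A₁ : Matrix (Fin n₁) (Fin n₁) ℝ}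
    {E₂ A₂ : Matrix (Fin n₂) (Fin n₂) ℝ} (h₁ : StablePair E₁ A₁) (h₂ : StablePair E₂ A₂)
    (B₁ : Matrix (Fin n₁) κm ℝ) (B₂ : Matrix (Fin n₂) κm ℝ) (C₁ : Matrix κp (Fin n₁) ℝ)
    (C₂ : Matrix κp (Fin n₂) ℝ) (D : Matrix κp κm ℝ) :
    ∃ (n : ℕ) (E A : Matrix (Fin n) (Fin n) ℝ) (B : Matrix (Fin n) κm ℝ)
      (C : Matrix κp (Fin n) ℝ), StablePair E A ∧ ∀ s : ℂ, 0 ≤ s.re →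
        transfer E A B C D s = transfer E₁ A₁ B₁ C₁ D s + transfer E₂ A₂ B₂ C₂ 0 s := by
  let e : Fin (n₁ + n₂) ≃ Fin n₁ ⊕ Fin n₂ := finSumFinEquiv.symm
  set E := (Matrix.fromBlocks E₁ 0 0 E₂).submatrix e e with hE
  set A := (Matrix.fromBlocks A₁ 0 0 A₂).submatrix e e with hA
  have hpencil (s : ℂ) : s • cplx E - cplx A = (Matrix.fromBlocks (s • cplx E₁ - cplx A₁) 0 0
      (s • cplx E₂ - cplx A₂)).submatrix e e := by
    ext i j
    rcases hi : e i with a | a <;> rcases hj : e j with b | b <;>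
      simp [hE, hA, cplx, hi, hj]
  have hinv (s : ℂ) (hs : 0 ≤ s.re) :
      (Matrix.fromBlocks (s • cplx E₁ - cplx A₁) 0 0 (s • cplx E₂ - cplx A₂)) *
        (Matrix.fromBlocks (s • cplx E₁ - cplx A₁)⁻¹ 0 0 (s • cplx E₂ - cplx A₂)⁻¹) = 1 := by
    rw [Matrix.fromBlocks_multiply,
      Matrix.mul_nonsing_inv _ ((Matrix.isUnit_iff_isUnit_det _).1 (h₁ s hs)),
      Matrix.mul_nonsing_inv _ ((Matrix.isUnit_iff_isUnit_det _).1 (h₂ s hs))]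
    simp
  refine ⟨n₁ + n₂, E, A, (Matrix.fromRows B₁ B₂).submatrix e id,
    (Matrix.fromCols C₁ C₂).submatrix id e, fun s hs => ?_, fun s hs => ?_⟩
  · rw [hpencil, Matrix.isUnit_submatrix_equiv]
    exact IsUnit.of_mul_eq_one _ (hinv s hs)
  · have hB : cplx ((Matrix.fromRows B₁ B₂).submatrix e id) =
        (Matrix.fromRows (cplx B₁) (cplx B₂)).submatrix e id := by
      ext i j
      rcases hi : e i with a | a <;> simp [cplx, hi]
    have hC : cplx ((Matrix.fromCols C₁ C₂).submatrix id e) =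
        (Matrix.fromCols (cplx C₁) (cplx C₂)).submatrix id e := by
      ext i j
      rcases hj : e j with a | a <;> simp [cplx, hj]
    rw [transfer, hpencil, Matrix.inv_submatrix_equiv, Matrix.inv_eq_right_inv (hinv s hs), hB, hC,
      Matrix.submatrix_mul_equiv, Matrix.submatrix_mul_equiv, Matrix.submatrix_id_id,
      Matrix.fromCols_mul_fromBlocks, Matrix.fromCols_mul_fromRows, transfer, transfer, cplx_zero]
    simp only [Matrix.mul_zero, add_zero, zero_add]
    abel

end Realization

lemma transfer_one {ι κm κp : Type*} [Fintype ι] [DecidableEq ι] {A : Matrix ι ι ℝ}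
    {B : Matrix ι κm ℝ} {C : Matrix κp ι ℝ} (D : Matrix κp κm ℝ) (s : ℂ) :
    transfer 1 A B C D s = cplx C * (s • 1 - cplx A)⁻¹ * cplx B + cplx D := by
  rw [transfer, cplx_one]

section Normalized

open scoped ComplexOrder

variable {ι κm κp : Type*} [Fintype ι] [DecidableEq ι] [Fintype κm] [Fintype κp]
  {A P Q : Matrix ι ι ℝ} {B : Matrix ι κm ℝ} {C : Matrix κp ι ℝ} {σ : ℝ}

lemma AntistablePair.isUnit_one_sub (hA : AntistablePair 1 A) (s : ℂ) (hs : s.re ≤ 0) :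
    IsUnit (s • (1 : Matrix ι ι ℂ) - cplx A) := by
  simpa only [cplx_one] using hA.2 s hs

lemma IsGramians.controllability (h : IsGramians 1 A B C P Q) :
    cplx A * cplx P + cplx P * (cplx A)ᴴ + cplx B * (cplx B)ᴴ = 0 := by
  have := congrArg cplx h.2.2.1
  simpa only [Matrix.transpose_one, Matrix.mul_one, Matrix.one_mul, cplx_add, cplx_mul,
    cplx_transpose, cplx_zero] using this

lemma IsGramians.observability (h : IsGramians 1 A B C P Q) :
    (cplx A)ᴴ * cplx Q + cplx Q * cplx A + (cplx C)ᴴ * cplx C = 0 := by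
  have := congrArg cplx h.2.2.2
  simpa only [Matrix.transpose_one, Matrix.mul_one, Matrix.one_mul, cplx_add, cplx_mul,
    cplx_transpose, cplx_zero] using this

lemma cplx_hankel_product :
    cplx (P * (1 : Matrix ι ι ℝ)ᵀ * Q * 1) = cplx P * cplx Q := by
  rw [Matrix.transpose_one, Matrix.mul_one, Matrix.mul_one, cplx_mul]

variable [DecidableEq κm]

lemma IsLargestHSV.le_error (hA : AntistablePair 1 A) (hX : IsGramians 1 A B C P Q)
    (hσ : IsLargestHSV 1 P Q σ) {c : ℝ} (hc : c < σ) (F : ℂ → Matrix κp κm ℂ)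
    (hF : RatMatOn (Metric.closedBall 0 1 \ {1}) fun z => F (cayley z)) :
    ∃ ω : ℝ, c < spec2 (transfer 1 A B C 0 (iax ω) - F (iax ω)) := by
  by_contra! h
  have hc0 : 0 ≤ c := (spec2_nonneg _).trans (h 0)
  have hσ0 : (σ : ℂ) ^ 2 ≠ 0 := by
    have : σ ≠ 0 := by linarith
    exact_mod_cast pow_ne_zero 2 this
  have hspec := hσ.2.1
  rw [cplx_hankel_product, ← Matrix.spectrum_toLin', ← Module.End.hasEigenvalue_iff_mem_spectrum]
    at hspec
  obtain ⟨y, hy⟩ := hspec.exists_hasEigenvector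
  have hy1 : cplx P *ᵥ (cplx Q *ᵥ y) = (σ : ℂ) ^ 2 • y := by
    have := hy.apply_eq_smul
    rwa [Matrix.toLin'_apply, ← Matrix.mulVec_mulVec] at this
  refine hankel_lower_bound hA.isUnit_one_sub (cplx_isHermitian hX.1) (cplx_isHermitian hX.2.1)
    hX.controllability hX.observability hc0 hc (x := cplx Q *ᵥ y) ?_ ?_ F hF fun ω u => ?_
  · intro h0
    rw [h0, Matrix.mulVec_zero] at hy1
    exact hy.2 ((smul_eq_zero.1 hy1.symm).resolve_left hσ0)
  · rw [hy1, Matrix.mulVec_smul]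
  · have := (spec2_le_iff _ hc0).1 (h ω) u
    rwa [transfer_one, cplx_zero, add_zero] at this

lemma spec2_error_le (hA : AntistablePair 1 A) (hX : IsGramians 1 A B C P Q) (hσ0 : 0 ≤ σ)
    {ω : ℝ} {N : Matrix ι κm ℂ} {T : Matrix κp κm ℂ} (hT : T = cplx C * cplx P * N)
    (hN : (cplx Q * cplx P - ((σ ^ 2 : ℝ) : ℂ) • 1) * (iax ω • 1 + (cplx A)ᴴ) * N +
      cplx Q * (cplx B * (cplx B)ᴴ) * N = cplx Q * cplx B) :
    spec2 (transfer 1 A B C 0 (iax ω) - T) ≤ σ := by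
  rw [spec2_le_iff _ hσ0]
  intro u
  have hdet := (Matrix.isUnit_iff_isUnit_det _).1 (hA.isUnit_one_sub (iax ω) (by simp [iax]))
  have h := error_energy_le (cplx_isHermitian hX.1) (cplx_isHermitian hX.2.1) hX.controllability
    hX.observability (σ := σ) (ω := ω) (u := u)
    (w := (iax ω • 1 - cplx A)⁻¹ *ᵥ (cplx B *ᵥ u)) (x := N *ᵥ u) ?_ ?_
  · convert h using 4 <;>
    · rw [hT, transfer_one, cplx_zero, add_zero]
      simp only [Matrix.sub_mulVec, Matrix.mulVec_sub, ← Matrix.mulVec_mulVec]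
  · have := congrArg (· *ᵥ (cplx B *ᵥ u)) (Matrix.mul_nonsing_inv _ hdet)
    simp only [Matrix.one_mulVec, ← Matrix.mulVec_mulVec] at this
    simpa only [Matrix.sub_mulVec, Matrix.smul_mulVec, Matrix.one_mulVec] using this
  · have := congrArg (· *ᵥ u) hN
    simpa only [Matrix.add_mulVec, Matrix.sub_mulVec, Matrix.smul_mulVec, Matrix.one_mulVec,
      ← Matrix.mulVec_mulVec, Complex.ofReal_pow] using this

/-- The anticausal part is approximated with error `σ` by a stable system. -/
lemma IsLargestHSV.exists_optimal (hA : AntistablePair 1 A) (hX : IsGramians 1 A B C P Q)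
    (hσ : IsLargestHSV 1 P Q σ) :
    ∃ (E' A' : Matrix ι ι ℝ) (B' : Matrix ι κm ℝ) (C' : Matrix κp ι ℝ), StablePair E' A' ∧
      ∀ ω : ℝ, spec2 (transfer 1 A B C 0 (iax ω) - transfer E' A' B' C' 0 (iax ω)) ≤ σ := by
  have hN := isUnit_smul_one_add_conjTranspose hA.isUnit_one_sub
  have hP := cplx_isHermitian hX.1
  have hQ := cplx_isHermitian hX.2.1
  have hLP := hX.controllability
  have hLQ := hX.observability
  have hK : (cplx P * (cplx Q * cplx P - ((σ ^ 2 : ℝ) : ℂ) • 1)).PosSemidef := by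
    refine posSemidef_mul_sub (posSemidef_neg_of_lyapunov hN hP hLP) hQ (sq_nonneg σ) ?_
    simpa only [cplx_hankel_product] using hσ.2.2
  rcases hσ.1.eq_or_lt with h0 | h0
  · have hQB : cplx Q * cplx B = 0 := by
      refine mul_input_eq_zero hP (posSemidef_neg_of_lyapunov (A := (cplx A)ᴴ) (B := (cplx C)ᴴ)
        ?_ hQ ?_) hLP hLQ ?_
      · refine isUnit_smul_one_add_conjTranspose fun s hs => ?_
        have := (hA.isUnit_one_sub (star s) (by simpa using hs)).star
        rw [Matrix.star_eq_conjTranspose] at this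
        simpa using this
      · simpa only [Matrix.conjTranspose_conjTranspose] using hLQ
      · simpa [← h0] using hK
    refine ⟨0, -1, 0, 0, fun s _ => ?_, fun ω => spec2_error_le hA hX hσ.1 (N := 0) ?_ ?_⟩
    · rw [cplx_zero, cplx_neg, cplx_one]
      simp
    · simp [transfer, cplx_zero]
    · simp [hQB]
  · set c : ℂ := ((σ ^ 2 : ℝ) : ℂ) with hc
    have hc0 : c ≠ 0 := by
      rw [hc]; exact_mod_cast (pow_pos h0 2).ne'
    obtain ⟨J, hRJ, hCJ, hJ⟩ := exists_kernel_projection (Q * P - σ ^ 2 • 1) (C * P)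
    have hRc : cplx (Q * P - σ ^ 2 • 1) = cplx Q * cplx P - c • 1 := by
      rw [cplx_sub, cplx_mul, cplx_smul, cplx_one]
    have hRJc := congrArg cplx hRJ
    have hCJc := congrArg cplx hCJ
    rw [cplx_mul, hRc, cplx_zero] at hRJc
    rw [cplx_mul, cplx_mul, cplx_zero] at hCJc
    rw [hRc, cplx_mul] at hJ
    have hker {s : ℂ} (hs : 0 ≤ s.re) {x : ι → ℂ} :=
      approximant_pencil_ker h0 hP hQ hN hLP hLQ hK hs (x := x)
    have hBJ : (cplx B)ᴴ * cplx J = 0 := by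
      refine Matrix.ext_of_mulVec_single fun i => ?_
      rw [← Matrix.mulVec_mulVec, Matrix.zero_mulVec]
      refine (hker (s := 0) le_rfl ?_).2.2
      rw [Matrix.mulVec_mulVec, Matrix.add_mul, Matrix.mul_assoc _ _ (cplx J), hRJc,
        Matrix.mul_zero, Matrix.mul_assoc (cplx C)ᴴ, Matrix.mul_assoc (cplx C)ᴴ, hCJc,
        Matrix.mul_zero, add_zero, Matrix.zero_mulVec]
    set A' := -(Aᵀ * (Q * P - σ ^ 2 • 1)) - Cᵀ * C * P - P * J with hA'
    have hpencil (s : ℂ) : s • cplx (Q * P - σ ^ 2 • 1) - cplx A' =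
        (s • 1 + (cplx A)ᴴ) * (cplx Q * cplx P - c • 1) + (cplx C)ᴴ * cplx C * cplx P +
          cplx P * cplx J := by
      rw [hRc, hA', cplx_sub, cplx_sub, cplx_neg, cplx_mul Aᵀ, hRc, cplx_mul _ P, cplx_mul P,
        cplx_mul, cplx_transpose, cplx_transpose, Matrix.add_mul, Matrix.smul_mul, Matrix.one_mul]
      abel
    have hproj {s : ℂ} {x : ι → ℂ} {u : κm → ℂ} :=
      projection_mulVec_eq_zero (s := s) (x := x) (u := u) hc0 hP hLP hLQ hK.1 hQ hRJc hBJ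
    have hstable : StablePair (Q * P - σ ^ 2 • 1) A' := fun s hs => by
      rw [hpencil, ← Matrix.mulVec_injective_iff_isUnit]
      refine (injective_iff_map_eq_zero (Matrix.mulVecLin _)).2 fun x hx => ?_
      rw [Matrix.mulVecLin_apply] at hx
      have hJx := hproj (s := s) (x := x) (u := 0) (by simpa using hx)
      rw [Matrix.add_mulVec, ← Matrix.mulVec_mulVec, hJx, Matrix.mulVec_zero, add_zero] at hx
      obtain ⟨h1, h2, -⟩ := hker hs hx
      rw [← hJ x h1 h2, hJx]
    refine ⟨Q * P - σ ^ 2 • 1, A', Q * B, C * P, hstable, fun ω => ?_⟩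
    have hs : 0 ≤ (iax ω).re := by simp [iax]
    have hdet := (Matrix.isUnit_iff_isUnit_det _).1 (hstable _ hs)
    refine spec2_error_le hA hX hσ.1
      (N := (iax ω • cplx (Q * P - σ ^ 2 • 1) - cplx A')⁻¹ * cplx (Q * B)) ?_ ?_
    · rw [transfer, cplx_zero, add_zero, cplx_mul C, Matrix.mul_assoc]
    · set N := (iax ω • cplx (Q * P - σ ^ 2 • 1) - cplx A')⁻¹ * cplx (Q * B) with hNdef
      have hMN : ((iax ω • 1 + (cplx A)ᴴ) * (cplx Q * cplx P - c • 1) +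
          (cplx C)ᴴ * cplx C * cplx P + cplx P * cplx J) * N = cplx Q * cplx B := by
        rw [← hpencil, hNdef, ← Matrix.mul_assoc, Matrix.mul_nonsing_inv _ hdet, Matrix.one_mul,
          cplx_mul]
      have hJN : cplx J * N = 0 := by
        refine Matrix.ext_of_mulVec_single fun i => ?_
        rw [← Matrix.mulVec_mulVec, Matrix.zero_mulVec]
        refine hproj (s := iax ω) (u := Pi.single i 1) ?_
        rw [Matrix.mulVec_mulVec, hMN, Matrix.mulVec_mulVec]
      rw [Matrix.add_mul, Matrix.mul_assoc (cplx P), hJN, Matrix.mul_zero, add_zero,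
        approximant_pencil_eq hLP hLQ, Matrix.add_mul] at hMN
      exact hMN

end Normalized

section Normalization

variable {ι κm κp : Type*} [Fintype ι] [DecidableEq ι] {E A Xc Xo : Matrix ι ι ℝ}

lemma AntistablePair.normalize (h : AntistablePair E A) : AntistablePair 1 (E⁻¹ * A) := by
  refine ⟨isUnit_one, fun s hs => ?_⟩
  have hu : IsUnit (cplx E) :=
    IsUnit.of_mul_eq_one (cplx E⁻¹) (by
      rw [← cplx_mul, Matrix.mul_nonsing_inv _ ((Matrix.isUnit_iff_isUnit_det _).1 h.1), cplx_one])
  refine (hu.mul_left_iff).1 ?_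
  have := h.2 s hs
  rwa [Matrix.mul_sub, Matrix.mul_smul, ← cplx_mul, ← cplx_mul, Matrix.mul_one,
    Matrix.mul_nonsing_inv_cancel_left _ _ ((Matrix.isUnit_iff_isUnit_det _).1 h.1)]

lemma IsGramians.normalize [Fintype κm] [Fintype κp] {B : Matrix ι κm ℝ} {C : Matrix κp ι ℝ}
    (hE : IsUnit E) (h : IsGramians E A B C Xc Xo) :
    IsGramians 1 (E⁻¹ * A) (E⁻¹ * B) C Xc (Eᵀ * Xo * E) := by
  have hdet := (Matrix.isUnit_iff_isUnit_det _).1 hE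
  have h1 : E⁻¹ * E = 1 := Matrix.nonsing_inv_mul _ hdet
  have h2 : Eᵀ * (E⁻¹)ᵀ = 1 := by rw [← Matrix.transpose_mul, h1, Matrix.transpose_one]
  have h3 : (E⁻¹)ᵀ * Eᵀ = 1 := by
    rw [← Matrix.transpose_mul, Matrix.mul_nonsing_inv _ hdet, Matrix.transpose_one]
  refine ⟨h.1, ?_, ?_, ?_⟩
  · rw [Matrix.IsSymm, Matrix.transpose_mul, Matrix.transpose_mul, Matrix.transpose_transpose,
      h.2.1.eq, Matrix.mul_assoc]
  · have := congrArg (fun X => E⁻¹ * X * (E⁻¹)ᵀ) h.2.2.1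
    simp only [Matrix.mul_add, Matrix.add_mul, Matrix.mul_zero, Matrix.zero_mul] at this
    rw [← this]
    congr 1
    · congr 1
      · rw [show E⁻¹ * (A * Xc * Eᵀ) * (E⁻¹)ᵀ = E⁻¹ * A * Xc * (Eᵀ * (E⁻¹)ᵀ) by
          simp only [Matrix.mul_assoc], h2, Matrix.transpose_one]
      · rw [show E⁻¹ * (E * Xc * Aᵀ) * (E⁻¹)ᵀ = (E⁻¹ * E) * Xc * (Aᵀ * (E⁻¹)ᵀ) by
          simp only [Matrix.mul_assoc], h1, ← Matrix.transpose_mul]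
    · rw [Matrix.transpose_mul]
      simp only [Matrix.mul_assoc]
  · rw [← h.2.2.2]
    congr 1
    rw [Matrix.transpose_mul, Matrix.transpose_one, Matrix.mul_one, Matrix.one_mul]
    congr 1
    · rw [show Aᵀ * (E⁻¹)ᵀ * (Eᵀ * Xo * E) = Aᵀ * ((E⁻¹)ᵀ * Eᵀ) * Xo * E by
        simp only [Matrix.mul_assoc], h3, Matrix.mul_one]
    · rw [Matrix.mul_assoc _ E, Matrix.mul_nonsing_inv_cancel_left _ _ hdet]

lemma IsLargestHSV.normalize {σ : ℝ} (h : IsLargestHSV E Xc Xo σ) :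
    IsLargestHSV 1 Xc (Eᵀ * Xo * E) σ := by
  have : Xc * (1 : Matrix ι ι ℝ)ᵀ * (Eᵀ * Xo * E) * 1 = Xc * Eᵀ * Xo * E := by
    simp [Matrix.mul_assoc]
  rwa [IsLargestHSV, this]

lemma ratMatOn_transfer {B : Matrix ι κm ℝ} {C : Matrix κp ι ℝ} (h : StablePair E A)
    (D : Matrix κp κm ℝ) :
    RatMatOn (Metric.closedBall 0 1 \ {1}) fun z => transfer E A B C D (cayley z) :=
  (((RatMatOn.const _).mul (ratMatOn_resolvent h)).mul (RatMatOn.const _)).add (RatMatOn.const _)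

end Normalization

theorem stmt19 {np nm m p : ℕ}
    (Ep Ap : Matrix (Fin np) (Fin np) ℝ) (Bp : Matrix (Fin np) (Fin m) ℝ)
    (Cp : Matrix (Fin p) (Fin np) ℝ) (D : Matrix (Fin p) (Fin m) ℝ)
    (Em Am : Matrix (Fin nm) (Fin nm) ℝ) (Bm : Matrix (Fin nm) (Fin m) ℝ)
    (Cm : Matrix (Fin p) (Fin nm) ℝ)
    (hp : StablePair Ep Ap) (hm : AntistablePair Em Am)
    (Xc Xo : Matrix (Fin nm) (Fin nm) ℝ) (hX : IsGramians Em Am Bm Cm Xc Xo)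
    (σ1 : ℝ) (hσ : IsLargestHSV Em Xc Xo σ1) :
    (∀ (n' : ℕ) (E' A' : Matrix (Fin n') (Fin n') ℝ) (B' : Matrix (Fin n') (Fin m) ℝ)
        (C' : Matrix (Fin p) (Fin n') ℝ) (D' : Matrix (Fin p) (Fin m) ℝ),
      StablePair E' A' → ∀ ε : ℝ, 0 < ε →
      ∃ ω : ℝ, σ1 - ε < spec2 (transfer Ep Ap Bp Cp D (iax ω) +
        transfer Em Am Bm Cm 0 (iax ω) - transfer E' A' B' C' D' (iax ω))) ∧
    (∃ (n' : ℕ) (E' A' : Matrix (Fin n') (Fin n') ℝ) (B' : Matrix (Fin n') (Fin m) ℝ)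
        (C' : Matrix (Fin p) (Fin n') ℝ) (D' : Matrix (Fin p) (Fin m) ℝ),
      StablePair E' A' ∧ ∀ ω : ℝ,
        spec2 (transfer Ep Ap Bp Cp D (iax ω) + transfer Em Am Bm Cm 0 (iax ω) -
          transfer E' A' B' C' D' (iax ω)) ≤ σ1) := by
  have hA := hm.normalize
  have hG := hX.normalize hm.1
  have hS := hσ.normalize
  simp only [transfer_normalize hm.1]
  refine ⟨fun n' E' A' B' C' D' h' ε hε => ?_, ?_⟩
  · obtain ⟨ω, hω⟩ := hS.le_error hA hG (sub_lt_self σ1 hε)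
      (fun s => transfer E' A' B' C' D' s - transfer Ep Ap Bp Cp D s)
      ((ratMatOn_transfer h' D').sub (ratMatOn_transfer hp D))
    refine ⟨ω, ?_⟩
    convert hω using 2
    abel
  · obtain ⟨E₂, A₂, B₂, C₂, h₂, herr⟩ := hS.exists_optimal hA hG
    obtain ⟨n, E, A, B, C, hst, htr⟩ := exists_parallel hp h₂ Bp B₂ Cp C₂ D
    refine ⟨n, E, A, B, C, D, hst, fun ω => ?_⟩
    rw [htr _ (by simp [iax]), add_sub_add_left_eq_sub]
    exact herr ω

end
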